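/- arXiv:2110.09068 — 7 statements merged into one kernel-verified Lean document; each statement's English description precedes it below -/
import Mathlib

section
/- Let n ∈ ℕ and let ℓ, u ∈ ℕⁿ be degree interval bounds with ℓᵢ ≤ uᵢ ≤ ℓᵢ + 1 for every i ∈ [n]. For m ∈ ℕ let w_m = |G_m(ℓ,u)| denote the number of graphs on [n] with exactly m edges whose degree sequence lies between ℓ and u componentwise. Then for every m ≥ 1 one has w_{m−1} · w_{m+1} ≤ w_m²; that is, the sequence (w_m)_{m∈ℕ} is log-concave. -/
/-- The degree of vertex `i` in a simple graph on `Fin n`. -/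
noncomputable def degOf {n : ℕ} (G : SimpleGraph (Fin n)) (i : Fin n) : ℕ :=
  (G.neighborSet i).ncard

/-- `wSeq n ℓ u m` is the number of simple graphs on `[n]` with exactly `m` edges whose
degree sequence lies between `ℓ` and `u` componentwise, i.e. `|G_m(ℓ,u)|`. -/
noncomputable def wSeq (n : ℕ) (ℓ u : Fin n → ℕ) (m : ℕ) : ℕ :=
  {G : SimpleGraph (Fin n) |
    (∀ i, ℓ i ≤ degOf G i ∧ degOf G i ≤ u i) ∧ G.edgeSet.ncard = m}.ncard

section Transitions

open Finset

variable {E : Type*} [DecidableEq E]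

/-- A two-colouring is balanced on `s` if its colour classes in `s` differ in size by at most one. -/
def BalancedOn (s : Finset E) (c : E → Bool) : Prop :=
  ∀ b, #{e ∈ s | c e = b} ≤ #{e ∈ s | c e = !b} + 1

/-- An involution pairing up the elements of `s`, except at most one, such that paired elements
have different colours. -/
structure IsTransition (s : Finset E) (c : E → Bool) (σ : Equiv.Perm E) : Prop where
  invol : ∀ e, σ (σ e) = e
  fix_of_notMem : ∀ e ∉ s, σ e = e
  eq_of_fix : ∀ e ∈ s, ∀ e' ∈ s, σ e = e → σ e' = e' → e = e'
  alternating : ∀ e, σ e ≠ e → c (σ e) = !c e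

omit [DecidableEq E] in
theorem IsTransition.apply_mem {s : Finset E} {c : E → Bool} {σ : Equiv.Perm E}
    (h : IsTransition s c σ) {e : E} (he : e ∈ s) : σ e ∈ s := by
  by_contra hn
  have h1 := h.fix_of_notMem _ hn
  rw [h.invol] at h1
  exact hn (h1 ▸ he)

theorem IsTransition.balancedOn {s : Finset E} {c : E → Bool} {σ : Equiv.Perm E}
    (h : IsTransition s c σ) : BalancedOn s c := by
  intro b
  have h1 : {e ∈ s | c e = b} ⊆ ({e ∈ s | c e = !b}.image σ) ∪ {e ∈ s | σ e = e} := by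
    intro e he
    simp only [mem_filter, mem_union, mem_image] at he ⊢
    by_cases hf : σ e = e
    · exact Or.inr ⟨he.1, hf⟩
    · exact Or.inl ⟨σ e, ⟨h.apply_mem he.1, by rw [h.alternating e hf, he.2]⟩, h.invol e⟩
  have h2 : #{e ∈ s | σ e = e} ≤ 1 := card_le_one.2 fun a ha b hb => by
    simp only [mem_filter] at ha hb
    exact h.eq_of_fix a ha.1 b hb.1 ha.2 hb.2
  have h3 := (card_le_card h1).trans (card_union_le _ _)
  have h4 : #({e ∈ s | c e = !b}.image σ) ≤ #{e ∈ s | c e = !b} := card_image_le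
  lia

omit [DecidableEq E] in
theorem isTransition_not_iff {s : Finset E} {c : E → Bool} {σ : Equiv.Perm E} :
    IsTransition s (fun e => !c e) σ ↔ IsTransition s c σ := by
  constructor
  · rintro ⟨h1, h2, h3, h4⟩
    exact ⟨h1, h2, h3, fun e he => by simpa using h4 e he⟩
  · rintro ⟨h1, h2, h3, h4⟩
    exact ⟨h1, h2, h3, fun e he => by simpa using h4 e he⟩

theorem BalancedOn.exists_isTransition {s : Finset E} {c : E → Bool} (h : BalancedOn s c) :
    ∃ σ, IsTransition s c σ := by
  induction s using Finset.strongInduction with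
  | H s ih =>
    by_cases hx : ∃ x ∈ s, ∃ y ∈ s, c x ≠ c y
    · obtain ⟨x, hx, y, hy, hxy⟩ := hx
      have hne : x ≠ y := fun h => hxy (h ▸ rfl)
      set t := (s.erase x).erase y with ht
      have hyx : y ∈ s.erase x := mem_erase.2 ⟨hne.symm, hy⟩
      have hs : s = insert x (insert y t) := by
        rw [ht, insert_erase hyx, insert_erase hx]
      have hyt : y ∉ t := by simp [ht]
      have hxt : x ∉ t := by simp [ht]
      have hcard (b : Bool) : #{e ∈ s | c e = b} = #{e ∈ t | c e = b} + 1 := by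
        rw [hs, filter_insert, filter_insert]
        have : (c x = b ∧ c y ≠ b) ∨ (c x ≠ b ∧ c y = b) := by
          revert hxy; cases c x <;> cases c y <;> cases b <;> simp
        rcases this with ⟨h1, h2⟩ | ⟨h1, h2⟩
        · rw [if_pos h1, if_neg h2, card_insert_of_notMem (by simp [hxt])]
        · rw [if_neg h1, if_pos h2, card_insert_of_notMem (by simp [hyt])]
      obtain ⟨σ, hσ⟩ := ih t (by
        rw [ht]; exact (erase_ssubset hyx).trans (erase_ssubset hx)) (fun b => by
          have := h b; rw [hcard, hcard] at this; lia)
      have hsx : σ x = x := hσ.fix_of_notMem x hxt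
      have hsy : σ y = y := hσ.fix_of_notMem y hyt
      have key (e : E) : (e = x ∧ (σ * Equiv.swap x y) e = y) ∨
          (e = y ∧ (σ * Equiv.swap x y) e = x) ∨
          (e ≠ x ∧ e ≠ y ∧ (σ * Equiv.swap x y) e = σ e) := by
        by_cases h1 : e = x
        · left; simp [h1, hsy]
        · by_cases h2 : e = y
          · right; left; simp [h2, hsx]
          · right; right
            simp [h1, h2, Equiv.swap_apply_of_ne_of_ne]
      have hcxy : c x = !c y := by revert hxy; cases c x <;> cases c y <;> simp
      refine ⟨σ * Equiv.swap x y, ⟨?_, ?_, ?_, ?_⟩⟩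
      · intro e
        have i1 := hσ.invol e
        have : σ e = x → e = x := fun h => σ.injective (h.trans hsx.symm)
        have : σ e = y → e = y := fun h => σ.injective (h.trans hsy.symm)
        rcases key e with k | k | k <;> rcases key ((σ * Equiv.swap x y) e) with k' | k' | k' <;>
          grind
      · intro e he
        have : e ∉ t := fun h => he (by rw [hs]; simp [h])
        have := hσ.fix_of_notMem e this
        rcases key e with k | k | k <;> grind
      · intro e he e' he' h1 h2
        have i1 := hσ.eq_of_fix e
        have i2 := i1
        rw [hs] at he he'
        rcases key e with k | k | k <;> rcases key e' with k' | k' | k' <;> grind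
      · intro e he
        have := hσ.alternating e
        have hcyx : c y = !c x := by rw [hcxy, Bool.not_not]
        rcases key e with ⟨k, k'⟩ | ⟨k, k'⟩ | ⟨-, -, k⟩
        · rw [k', k, hcyx]
        · rw [k', k, hcxy]
        · rw [k] at he ⊢
          exact this he
    · push Not at hx
      refine ⟨1, fun _ => rfl, fun _ _ => rfl, fun x hxs y hys _ _ => ?_, fun e he => (he rfl).elim⟩
      have h1 := h (c x)
      have h2 : #{e ∈ s | c e = !c x} = 0 := by
        rw [card_eq_zero, filter_eq_empty_iff]
        intro e he
        rw [hx e he x hxs]; cases c x <;> simp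
      rw [h2, zero_add, card_le_one] at h1
      exact h1 x (by simp [hxs]) y (by simp [hys, hx y hys x hxs])

variable [Fintype E]

omit [DecidableEq E] in
theorem exists_perm_of_card_filter_eq {s : Finset E} {c d : E → Bool}
    (h : ∀ b, #{e ∈ s | c e = b} = #{e ∈ s | d e = b}) :
    ∃ τ : Equiv.Perm E, (∀ e, τ e ∈ s ↔ e ∈ s) ∧ ∀ e ∈ s, d (τ e) = c e := by
  classical
  let f (c : E → Bool) (e : E) : Option Bool := if e ∈ s then some (c e) else none
  have hf (b : Option Bool) : Nonempty ({ e // f c e = b } ≃ { e // f d e = b }) := by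
    rw [← Fintype.card_eq, Fintype.card_subtype, Fintype.card_subtype]
    cases b with
    | none => simp [f]
    | some b =>
      have (c : E → Bool) : ({e | f c e = some b} : Finset E) = {e ∈ s | c e = b} := by
        ext e; simp [f]
      rw [this, this, h]
  have hg := Equiv.ofFiberEquiv_map (fun b => (hf b).some)
  set τ := Equiv.ofFiberEquiv (fun b => (hf b).some)
  refine ⟨τ, fun e => ?_, fun e he => ?_⟩
  · have := hg e
    simp only [f] at this
    split_ifs at this <;> simp_all
  · have := hg e
    simp only [f, he, if_true] at this
    split_ifs at this
    simpa using this

open Classical in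
theorem card_isTransition_le {s : Finset E} {c d : E → Bool}
    (h : ∀ b, #{e ∈ s | c e = b} = #{e ∈ s | d e = b}) :
    #{σ | IsTransition s c σ} ≤ #{σ | IsTransition s d σ} := by
  obtain ⟨τ, hs, hτ⟩ := exists_perm_of_card_filter_eq h
  refine card_le_card_of_injOn (fun σ => τ * σ * τ⁻¹) (fun σ hσ => ?_) (fun σ _ ρ _ h => ?_)
  · simp only [coe_filter, mem_univ, true_and, Set.mem_ofPred_eq] at hσ ⊢
    refine ⟨fun e => ?_, fun e he => ?_, fun e he e' he' h1 h2 => ?_, fun e he => ?_⟩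
    · simp [hσ.invol]
    · obtain ⟨e, rfl⟩ := τ.surjective e
      simp [hσ.fix_of_notMem e (by rwa [← hs])]
    · obtain ⟨e, rfl⟩ := τ.surjective e
      obtain ⟨e', rfl⟩ := τ.surjective e'
      rw [hs] at he he'
      exact congrArg τ (hσ.eq_of_fix e he e' he' (by simpa using h1) (by simpa using h2))
    · obtain ⟨e, rfl⟩ := τ.surjective e
      have h1 : σ e ≠ e := by simpa using he
      have h2 : e ∈ s := by
        by_contra hn
        exact h1 (hσ.fix_of_notMem e hn)
      simp [hτ _ h2, hτ _ (hσ.apply_mem h2), hσ.alternating e h1]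
  · simpa using h

open Classical in
theorem BalancedOn.card_isTransition_eq {s : Finset E} {c d : E → Bool}
    (hc : BalancedOn s c) (hd : BalancedOn s d) :
    #{σ | IsTransition s c σ} = #{σ | IsTransition s d σ} := by
  have hsum (c : E → Bool) : #{e ∈ s | c e = true} + #{e ∈ s | c e = false} = #s := by
    rw [← card_filter_add_card_filter_not (s := s) (fun e => c e = true)]
    simp
  have c1 := hc true; have c2 := hc false
  have d1 := hd true; have d2 := hd false
  have hcs := hsum c; have hds := hsum d
  simp only [Bool.not_true, Bool.not_false] at c1 c2 d1 d2
  rcases eq_or_ne (#{e ∈ s | c e = true}) (#{e ∈ s | d e = true}) with h | h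
  · have : ∀ b, #{e ∈ s | c e = b} = #{e ∈ s | d e = b} := by
      rintro (_ | _) <;> lia
    exact (card_isTransition_le this).antisymm (card_isTransition_le fun b => (this b).symm)
  · have : ∀ b, #{e ∈ s | (!c e) = b} = #{e ∈ s | d e = b} := by
      rintro (_ | _) <;> simp only [Bool.not_eq_false', Bool.not_eq_true'] <;> lia
    have h1 := (card_isTransition_le this).antisymm (card_isTransition_le fun b => (this b).symm)
    simpa only [isTransition_not_iff] using h1

end Transitions

section Components

open Finset

variable {E : Type*} [Fintype E]

/-- Adjacent vertices receive different colours. -/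
def IsProper (Γ : SimpleGraph E) (c : E → Bool) : Prop :=
  ∀ e e', Γ.Adj e e' → c e ≠ c e'

open Classical in
theorem IsProper.card_component_le {Γ : SimpleGraph E} (hΓ : ∀ e, Γ.degree e ≤ 2)
    {c : E → Bool} (hc : IsProper Γ c) (C : Γ.ConnectedComponent) (b : Bool) :
    #{e | Γ.connectedComponentMk e = C ∧ c e = !b} ≤
      #{e | Γ.connectedComponentMk e = C ∧ c e = b} + 1 := by
  have h1 := C.connected_toSimpleGraph.card_vert_le_card_edgeSet_add_one
  set H := C.toSimpleGraph with hH
  let s : Finset C := {x | c x = b}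
  let t : Finset C := {x | c x = !b}
  have hbip : H.IsBipartiteWith s t := by
    refine ⟨?_, fun x y hxy => ?_⟩
    · rw [disjoint_coe, disjoint_filter]
      rintro x - h; rw [h]; cases b <;> simp
    · have h2 : Γ.Adj x y := hxy
      have h3 := hc _ _ h2
      simp only [s, t, coe_filter, mem_univ, true_and, Set.mem_ofPred_eq]
      revert h3; cases c x <;> cases c y <;> cases b <;> simp
  have h2 := SimpleGraph.isBipartiteWith_sum_degrees_eq_card_edges hbip
  have h3 : ∀ x ∈ s, H.degree x ≤ 2 := fun x _ => by
    refine le_trans ?_ (hΓ x)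
    rw [← SimpleGraph.card_neighborFinset_eq_degree, ← SimpleGraph.card_neighborFinset_eq_degree]
    refine card_le_card_of_injOn Subtype.val (fun y hy => ?_) Subtype.val_injective.injOn
    simp only [SimpleGraph.coe_neighborFinset, SimpleGraph.mem_neighborSet] at hy ⊢
    exact hy
  have h4 := sum_le_card_nsmul s _ 2 h3
  have hcard (b : Bool) : #{x : C | c x = b} = #{e | Γ.connectedComponentMk e = C ∧ c e = b} := by
    rw [← card_map (Function.Embedding.subtype _)]
    congr 1
    ext e
    simp only [mem_map, mem_filter, mem_univ, true_and, Function.Embedding.subtype_apply,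
      Subtype.exists]
    constructor
    · rintro ⟨a, ha, h, rfl⟩; exact ⟨ha, h⟩
    · rintro ⟨h, h'⟩; exact ⟨e, h, h', rfl⟩
  have h5 : #s + #t = Nat.card C := by
    rw [Nat.card_eq_fintype_card, ← card_univ,
      ← card_filter_add_card_filter_not (s := univ) (fun x : C => c x = b)]
    congr 2
    ext x; simp only [t, mem_filter]; cases c x <;> cases b <;> simp
  have h6 : #H.edgeFinset = Nat.card H.edgeSet := by
    rw [Nat.card_eq_fintype_card, SimpleGraph.edgeFinset_card]
  rw [← hcard, ← hcard]
  simp only [smul_eq_mul] at h4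
  change #t ≤ #s + 1
  lia

/-- `1` for `true`, `-1` for `false`. -/
def boolSign (b : Bool) : ℤ := bif b then 1 else -1

theorem boolSign_not (b : Bool) : boolSign (!b) = -boolSign b := by cases b <;> rfl

omit [Fintype E] in
theorem sum_boolSign (s : Finset E) (c : E → Bool) :
    ∑ e ∈ s, boolSign (c e) = #{e ∈ s | c e = true} - #{e ∈ s | c e = false} := by
  have (e : E) : boolSign (c e) =
      (if c e = true then 1 else 0) - (if c e = false then 1 else 0) := by
    cases c e <;> simp [boolSign]
  simp [this, sum_sub_distrib]

open Classical in
/-- The signed count of a connected component. -/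
noncomputable def componentSign (Γ : SimpleGraph E) (c : E → Bool) (C : Γ.ConnectedComponent) : ℤ :=
  ∑ e with Γ.connectedComponentMk e = C, boolSign (c e)

open Classical in
theorem sum_componentSign (Γ : SimpleGraph E) (c : E → Bool) :
    ∑ C, componentSign Γ c C = ∑ e, boolSign (c e) :=
  sum_fiberwise _ _ _

open Classical in
theorem IsProper.abs_componentSign {Γ : SimpleGraph E} (hΓ : ∀ e, Γ.degree e ≤ 2)
    {c : E → Bool} (hc : IsProper Γ c) (C : Γ.ConnectedComponent) :
    |componentSign Γ c C| = ((#{e | Γ.connectedComponentMk e = C} % 2 : ℕ) : ℤ) := by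
  have h1 := hc.card_component_le hΓ C true
  have h2 := hc.card_component_le hΓ C false
  have h3 : #{e | Γ.connectedComponentMk e = C ∧ c e = true} +
      #{e | Γ.connectedComponentMk e = C ∧ c e = false} = #{e | Γ.connectedComponentMk e = C} := by
    rw [← card_filter_add_card_filter_not (s := {e | Γ.connectedComponentMk e = C})
      (fun e => c e = true), filter_filter, filter_filter]
    simp
  rw [componentSign, sum_boolSign, filter_filter, filter_filter]
  simp only [Bool.not_true, Bool.not_false] at h1 h2
  rcases abs_cases ((#{e | Γ.connectedComponentMk e = C ∧ c e = true} : ℤ) -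
    #{e | Γ.connectedComponentMk e = C ∧ c e = false}) with h | h <;> lia

open Classical in
/-- Exchange the two colours on a connected component. -/
noncomputable def flipComponent (Γ : SimpleGraph E) (C : Γ.ConnectedComponent) (c : E → Bool) :
    E → Bool :=
  fun e => if Γ.connectedComponentMk e = C then !c e else c e

variable {Γ : SimpleGraph E}

omit [Fintype E] in
theorem flipComponent_flipComponent (C : Γ.ConnectedComponent) (c : E → Bool) :
    flipComponent Γ C (flipComponent Γ C c) = c := by
  funext e
  simp only [flipComponent]
  split_ifs <;> simp

omit [Fintype E] in
theorem IsProper.flipComponent {c : E → Bool} (hc : IsProper Γ c) (C : Γ.ConnectedComponent) :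
    IsProper Γ (flipComponent Γ C c) := by
  intro e e' h
  have h1 := hc e e' h
  have h2 : Γ.connectedComponentMk e = Γ.connectedComponentMk e' :=
    SimpleGraph.ConnectedComponent.sound h.reachable
  by_cases h3 : Γ.connectedComponentMk e' = C
  all_goals simp only [_root_.flipComponent, h2, h3, if_true, if_false]
  · exact fun h => h1 (Bool.not_inj h)
  · exact h1

theorem componentSign_flipComponent_self (C : Γ.ConnectedComponent) (c : E → Bool) :
    componentSign Γ (flipComponent Γ C c) C = -componentSign Γ c C := by
  rw [componentSign, componentSign, ← sum_neg_distrib]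
  refine sum_congr rfl fun e he => ?_
  simp only [mem_filter] at he
  simp [flipComponent, he.2, boolSign_not]

theorem componentSign_flipComponent_of_ne {C D : Γ.ConnectedComponent} (h : D ≠ C)
    (c : E → Bool) : componentSign Γ (flipComponent Γ C c) D = componentSign Γ c D := by
  rw [componentSign, componentSign]
  refine sum_congr rfl fun e he => ?_
  simp only [mem_filter] at he
  simp [flipComponent, he.2, h]

open Classical in
theorem sum_boolSign_flipComponent (C : Γ.ConnectedComponent) (c : E → Bool) :
    ∑ e, boolSign (flipComponent Γ C c e) = ∑ e, boolSign (c e) - 2 * componentSign Γ c C := by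
  rw [← sum_componentSign Γ, ← sum_componentSign Γ, ← add_sum_erase _ _ (mem_univ C),
    ← add_sum_erase _ (componentSign Γ c) (mem_univ C), componentSign_flipComponent_self,
    sum_congr rfl fun D hD => componentSign_flipComponent_of_ne (ne_of_mem_erase hD) c]
  ring

omit [Fintype E] in
theorem flipComponent_left_injective {c : E → Bool} {C D : Γ.ConnectedComponent}
    (h : flipComponent Γ C c = flipComponent Γ D c) : C = D := by
  obtain ⟨e, rfl⟩ := C.exists_rep
  have := congrFun h e
  by_contra hne
  have h1 : Γ.connectedComponentMk e ≠ D := hne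
  change flipComponent Γ (Γ.connectedComponentMk e) c e = _ at this
  simp [flipComponent, h1] at this

open Classical in
/-- In a graph of maximum degree two, proper two-colourings with equal colour classes are at least
as numerous as those with colour classes differing by two in a given direction. -/
theorem card_isProper_le (hΓ : ∀ e, Γ.degree e ≤ 2) :
    #{c : E → Bool | IsProper Γ c ∧ ∑ e, boolSign (c e) = -2} ≤
      #{c : E → Bool | IsProper Γ c ∧ ∑ e, boolSign (c e) = 0} := by
  set p : ℕ := ∑ C : Γ.ConnectedComponent, #{e | Γ.connectedComponentMk e = C} % 2 with hp
  have habs {c : E → Bool} (hc : IsProper Γ c) (C : Γ.ConnectedComponent) :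
      (componentSign Γ c C = 1 ∨ componentSign Γ c C = 0 ∨ componentSign Γ c C = -1) := by
    have := hc.abs_componentSign hΓ C
    rcases abs_cases (componentSign Γ c C) with h | h <;> lia
  have hcount {c : E → Bool} (hc : IsProper Γ c) :
      (#{C | componentSign Γ c C = 1} : ℤ) + #{C | componentSign Γ c C = -1} = p ∧
      (#{C | componentSign Γ c C = 1} : ℤ) - #{C | componentSign Γ c C = -1} =
        ∑ e, boolSign (c e) := by
    constructor
    · rw [hp, Nat.cast_sum, card_filter, card_filter, Nat.cast_sum, Nat.cast_sum,
        ← sum_add_distrib]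
      refine sum_congr rfl fun C _ => ?_
      rw [← hc.abs_componentSign hΓ C]
      rcases habs hc C with h | h | h <;> simp [h]
    · rw [← sum_componentSign Γ, card_filter, card_filter, Nat.cast_sum, Nat.cast_sum,
        ← sum_sub_distrib]
      refine sum_congr rfl fun C _ => ?_
      rcases habs hc C with h | h | h <;> simp [h]
  have key := card_mul_le_card_mul (m := p / 2 + 1) (n := p / 2)
    (s := {c : E → Bool | IsProper Γ c ∧ ∑ e, boolSign (c e) = -2})
    (t := {c : E → Bool | IsProper Γ c ∧ ∑ e, boolSign (c e) = 0})
    (fun c d => ∃ C, componentSign Γ c C = -1 ∧ d = flipComponent Γ C c) ?_ ?_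
  · rw [mul_add] at key
    by_contra! hlt
    have := Nat.mul_le_mul_right (p / 2) hlt.le
    lia
  · intro c hc
    simp only [mem_filter, mem_univ, true_and] at hc
    have h1 := hcount hc.1
    have h2 : p / 2 + 1 = #{C | componentSign Γ c C = -1} := by lia
    rw [h2]
    refine card_le_card_of_injOn (fun C => flipComponent Γ C c) (fun C hC => ?_)
      fun C _ D _ h => flipComponent_left_injective h
    simp only [coe_filter, mem_univ, true_and, Set.mem_ofPred_eq, mem_coe,
      mem_bipartiteAbove, mem_filter] at hC ⊢
    exact ⟨⟨hc.1.flipComponent C, by rw [sum_boolSign_flipComponent]; lia⟩, C, hC, rfl⟩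
  · intro d hd
    simp only [mem_filter, mem_univ, true_and] at hd
    have h1 := hcount hd.1
    have h2 : p / 2 = #{C | componentSign Γ d C = 1} := by lia
    rw [h2]
    refine (card_le_card (t := image (fun C => flipComponent Γ C d)
      {C | componentSign Γ d C = 1}) fun c hc => ?_).trans card_image_le
    simp only [mem_bipartiteBelow, mem_image, mem_filter, mem_univ, true_and] at hc ⊢
    obtain ⟨-, C, hC, rfl⟩ := hc
    exact ⟨C, by rw [componentSign_flipComponent_self, hC]; rfl, flipComponent_flipComponent C c⟩

end Components

section Colourings

open Finset

variable {E V : Type*} [Fintype E] [Fintype V]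

open Classical in
theorem card_isTransition_tuples (inc : V → Finset E) (c : E → Bool) :
    #{T : V → Equiv.Perm E | ∀ v, IsTransition (inc v) c (T v)} =
      ∏ v, #{σ | IsTransition (inc v) c σ} := by
  rw [← Fintype.card_piFinset]
  congr 1
  ext T
  simp

/-- The graph joining elements that are paired by one of the given permutations. -/
def transitionGraph (T : V → Equiv.Perm E) : SimpleGraph E :=
  SimpleGraph.fromRel fun e e' => ∃ v, T v e = e'

omit [Fintype E] [Fintype V] in
theorem transitionGraph_adj {inc : V → Finset E} {c : E → Bool} {T : V → Equiv.Perm E}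
    (hT : ∀ v, IsTransition (inc v) c (T v)) {e e' : E} :
    (transitionGraph T).Adj e e' ↔ e ≠ e' ∧ ∃ v, T v e = e' := by
  rw [transitionGraph, SimpleGraph.fromRel_adj]
  refine and_congr_right fun _ => or_iff_left_of_imp ?_
  rintro ⟨v, rfl⟩
  exact ⟨v, (hT v).invol e'⟩

omit [Fintype E] [Fintype V] in
theorem isProper_transitionGraph_iff {inc : V → Finset E} {c d : E → Bool} {T : V → Equiv.Perm E}
    (hT : ∀ v, IsTransition (inc v) c (T v)) :
    IsProper (transitionGraph T) d ↔ ∀ v, IsTransition (inc v) d (T v) := by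
  constructor
  · intro h v
    refine ⟨(hT v).invol, (hT v).fix_of_notMem, (hT v).eq_of_fix, fun e he => ?_⟩
    have := h e (T v e) ((transitionGraph_adj hT).2 ⟨he.symm, v, rfl⟩)
    exact Bool.eq_not_of_ne this.symm
  · intro h e e' hadj
    obtain ⟨hne, v, rfl⟩ := (transitionGraph_adj hT).1 hadj
    rw [(h v).alternating e hne.symm]
    cases d e <;> simp

open Classical in
theorem degree_transitionGraph_le {inc : V → Finset E} {c : E → Bool} {T : V → Equiv.Perm E}
    (hT : ∀ v, IsTransition (inc v) c (T v)) (e : E) :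
    (transitionGraph T).degree e ≤ #{v | e ∈ inc v} := by
  rw [← SimpleGraph.card_neighborFinset_eq_degree]
  refine (card_le_card (t := image (fun v => T v e) {v | e ∈ inc v}) fun e' he' => ?_).trans
    card_image_le
  rw [SimpleGraph.mem_neighborFinset, transitionGraph_adj hT] at he'
  obtain ⟨hne, v, rfl⟩ := he'
  refine mem_image.2 ⟨v, ?_, rfl⟩
  by_contra hn
  exact hne ((hT v).fix_of_notMem e (by simpa using hn)).symm

open Classical in
/-- Among the two-colourings of the edges of a graph that are balanced at each vertex, those with
equal colour classes are at least as numerous as those whose classes differ by two in a given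
direction. -/
theorem card_balancedOn_le (inc : V → Finset E) (hinc : ∀ e, #{v | e ∈ inc v} ≤ 2) :
    #{c : E → Bool | (∀ v, BalancedOn (inc v) c) ∧ ∑ e, boolSign (c e) = -2} ≤
      #{c : E → Bool | (∀ v, BalancedOn (inc v) c) ∧ ∑ e, boolSign (c e) = 0} := by
  let A (k : ℤ) : Finset (E → Bool) :=
    {c | (∀ v, BalancedOn (inc v) c) ∧ ∑ e, boolSign (c e) = k}
  let r (c : E → Bool) (T : V → Equiv.Perm E) : Prop := ∀ v, IsTransition (inc v) c (T v)
  change #(A (-2)) ≤ #(A 0)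
  rcases (A (-2)).eq_empty_or_nonempty with h0 | ⟨c₀, hc₀⟩
  · simp [h0]
  have hc₀' : ∀ v, BalancedOn (inc v) c₀ := by simp only [A, mem_filter] at hc₀; exact hc₀.2.1
  set M := ∏ v, #{σ | IsTransition (inc v) c₀ σ} with hM
  have hMpos : 0 < M := prod_pos fun v _ => by
    obtain ⟨σ, hσ⟩ := (hc₀' v).exists_isTransition
    exact card_pos.2 ⟨σ, by simpa using hσ⟩
  have hcount (k : ℤ) : #(A k) * M = ∑ T, #((A k).bipartiteBelow r T) := by
    rw [← sum_card_bipartiteAbove_eq_sum_card_bipartiteBelow, ← smul_eq_mul, ← sum_const]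
    refine sum_congr rfl fun c hc => ?_
    simp only [A, mem_filter] at hc
    rw [bipartiteAbove, card_isTransition_tuples, hM]
    exact prod_congr rfl fun v _ => (hc₀' v).card_isTransition_eq (hc.2.1 v)
  refine Nat.le_of_mul_le_mul_right ?_ hMpos
  rw [hcount, hcount]
  refine sum_le_sum fun T _ => ?_
  rcases ((A (-2)).bipartiteBelow r T).eq_empty_or_nonempty with h1 | ⟨c, hc⟩
  · simp [h1]
  have hT : r c T := ((mem_bipartiteBelow r).1 hc).2
  have hbelow (k : ℤ) : (A k).bipartiteBelow r T =
      ({d | IsProper (transitionGraph T) d ∧ ∑ e, boolSign (d e) = k} : Finset (E → Bool)) := by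
    ext d
    simp only [mem_bipartiteBelow, A, mem_filter, mem_univ, true_and,
      isProper_transitionGraph_iff hT]
    exact ⟨fun h => ⟨h.2, h.1.2⟩, fun h => ⟨⟨fun v => (h.1 v).balancedOn, h.2⟩, h.1⟩⟩
  rw [hbelow, hbelow]
  exact card_isProper_le fun e => (degree_transitionGraph_le hT e).trans (hinc e)

end Colourings

section EdgeSets

open Finset

variable {U V : Type*} [Fintype U] [DecidableEq U] [Fintype V]

/-- The sets of `k` elements meeting each `inc v` in between `ℓ v` and `u v` elements. -/
def intervalSets (inc : V → Finset U) (ℓ u : V → ℕ) (k : ℕ) : Finset (Finset U) :=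
  {S | (∀ v, ℓ v ≤ #{e ∈ S | e ∈ inc v} ∧ #{e ∈ S | e ∈ inc v} ≤ u v) ∧ #S = k}

omit [Fintype U] in
theorem card_filter_inter_add_symmDiff (S T : Finset U) (p : U → Prop) [DecidablePred p] :
    #{e ∈ S ∩ T | p e} + #{e ∈ ({e | p e} : Finset ↥(symmDiff S T)) | decide (e.1 ∈ S) = true} =
        #{e ∈ S | p e} ∧
    #{e ∈ S ∩ T | p e} + #{e ∈ ({e | p e} : Finset ↥(symmDiff S T)) | decide (e.1 ∈ S) = false} =
        #{e ∈ T | p e} := by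
  constructor
  all_goals
    rw [← card_map (Function.Embedding.subtype _) (s := filter _ (filter _ _)),
      ← card_union_of_disjoint]
    · congr 1
      ext e
      simp only [mem_union, mem_map, mem_filter, mem_inter, mem_univ, true_and,
        Function.Embedding.subtype_apply, Subtype.exists, mem_symmDiff, decide_eq_true_eq,
        decide_eq_false_iff_not]
      grind
    · rw [disjoint_left]
      intro e
      simp only [mem_map, mem_filter, mem_inter, mem_univ, true_and,
        Function.Embedding.subtype_apply, Subtype.exists, mem_symmDiff, decide_eq_true_eq,
        decide_eq_false_iff_not]
      grind

omit [Fintype U] in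
theorem exists_inter_symmDiff_of_colouring {I D : Finset U} (h : Disjoint I D) (c : D → Bool) :
    ∃ S T, S ∩ T = I ∧ symmDiff S T = D ∧ ∀ e : D, decide (e.1 ∈ S) = c e := by
  refine ⟨I ∪ ({e | c e = true} : Finset D).map (Function.Embedding.subtype _),
    I ∪ ({e | c e = false} : Finset D).map (Function.Embedding.subtype _), ?_, ?_, ?_⟩
  · ext e
    simp only [mem_union, mem_map, mem_filter, mem_inter, mem_univ, true_and,
      Function.Embedding.subtype_apply, Subtype.exists]
    grind
  · rw [disjoint_left] at h
    ext e
    simp only [mem_union, mem_map, mem_filter, mem_univ, true_and, mem_symmDiff,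
      Function.Embedding.subtype_apply, Subtype.exists]
    grind
  · rw [disjoint_left] at h
    rintro ⟨e, he⟩
    have : e ∉ I := fun h' => h h' he
    simp [this, he]

open Classical in
theorem card_fibre_le {inc : V → Finset U} (hinc : ∀ e, #{v | e ∈ inc v} ≤ 2) {ℓ u : V → ℕ}
    (h : ∀ v, ℓ v ≤ u v ∧ u v ≤ ℓ v + 1) {m : ℕ} (hm : 1 ≤ m) (I D : Finset U) :
    #{p ∈ intervalSets inc ℓ u (m - 1) ×ˢ intervalSets inc ℓ u (m + 1) |
        (p.1 ∩ p.2, symmDiff p.1 p.2) = (I, D)} ≤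
      #{p ∈ intervalSets inc ℓ u m ×ˢ intervalSets inc ℓ u m |
        (p.1 ∩ p.2, symmDiff p.1 p.2) = (I, D)} := by
  rcases eq_empty_or_nonempty {p ∈ intervalSets inc ℓ u (m - 1) ×ˢ intervalSets inc ℓ u (m + 1) |
    (p.1 ∩ p.2, symmDiff p.1 p.2) = (I, D)} with h0 | ⟨⟨S₀, T₀⟩, h0⟩
  · rw [h0, card_empty]
    exact Nat.zero_le _
  simp only [mem_filter, mem_product, Prod.mk.injEq, intervalSets, mem_univ, true_and] at h0
  obtain ⟨⟨⟨hS₀, hS₀m⟩, hT₀, hT₀m⟩, hI₀, hD₀⟩ := h0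
  have hID : Disjoint I D := by
    rw [← hI₀, ← hD₀]; exact (disjoint_symmDiff_inf S₀ T₀).symm
  let incD (v : V) : Finset D := {e | e.1 ∈ inc v}
  have hcount {S T : Finset U} (hI : S ∩ T = I) (hD : symmDiff S T = D) (v : V) :
      #{e ∈ I | e ∈ inc v} + #{e ∈ incD v | decide (e.1 ∈ S) = true} = #{e ∈ S | e ∈ inc v} ∧
      #{e ∈ I | e ∈ inc v} + #{e ∈ incD v | decide (e.1 ∈ S) = false} = #{e ∈ T | e ∈ inc v} := by
    subst hI hD
    exact card_filter_inter_add_symmDiff S T _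
  have htotal {S T : Finset U} (hI : S ∩ T = I) (hD : symmDiff S T = D) :
      #I + #{e : D | decide (e.1 ∈ S) = true} = #S ∧
      #I + #{e : D | decide (e.1 ∈ S) = false} = #T := by
    subst hI hD
    simpa only [filter_true] using card_filter_inter_add_symmDiff S T (fun _ => True)
  have hsum (s : Finset D) (c : D → Bool) :
      #{e ∈ s | c e = true} + #{e ∈ s | c e = false} = #s := by
    rw [← card_filter_add_card_filter_not (s := s) (fun e => c e = true)]
    simp
  refine le_trans ?_ ((card_balancedOn_le incD fun e => ?_).trans ?_)
  · refine card_le_card_of_injOn (fun p e => decide (e.1 ∈ p.1)) ?_ ?_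
    · rintro ⟨S, T⟩ hp
      simp only [mem_filter, mem_product, Prod.mk.injEq, intervalSets, mem_univ, true_and,
        coe_filter, Set.mem_ofPred_eq] at hp ⊢
      obtain ⟨⟨⟨hS, hSm⟩, hT, hTm⟩, hI, hD⟩ := hp
      refine ⟨fun v => ?_, ?_⟩
      · have h1 := hcount hI hD v
        have h2 := hS v
        have h3 := hT v
        have h4 := h v
        rintro (_ | _) <;> simp only [Bool.not_true, Bool.not_false] <;> lia
      · have h1 := htotal hI hD
        rw [sum_boolSign]
        lia
    · rintro ⟨S, T⟩ hp ⟨S', T'⟩ hp' heq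
      simp only [Prod.mk.injEq, coe_filter, Set.mem_ofPred_eq] at hp hp' ⊢
      obtain ⟨-, hI, hD⟩ := hp
      obtain ⟨-, hI', hD'⟩ := hp'
      have h1 (e : U) : e ∈ D → (e ∈ S ↔ e ∈ S') := fun he => by
        have := congrFun heq ⟨e, he⟩
        simpa using this
      have h2 (e : U) : e ∈ S ∩ T ↔ e ∈ S' ∩ T' := by rw [hI, hI']
      have h3 (e : U) : e ∈ symmDiff S T ↔ e ∈ symmDiff S' T' := by rw [hD, hD']
      rw [← hD] at h1
      simp only [mem_inter, mem_symmDiff] at h1 h2 h3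
      constructor <;> ext e <;> grind
  · simpa [incD] using hinc e
  · choose S T hI hD hc using fun c : D → Bool => exists_inter_symmDiff_of_colouring hID c
    refine card_le_card_of_injOn (fun c => (S c, T c)) ?_ ?_
    · intro c hcm
      simp only [mem_filter, mem_product, Prod.mk.injEq, intervalSets, mem_univ, true_and,
        coe_filter, Set.mem_ofPred_eq] at hcm ⊢
      have h1 := htotal (hI c) (hD c)
      have h1' := htotal hI₀ hD₀
      have h2 := hcm.2
      have h3 := hsum univ c
      have h3' := hsum univ fun e => decide (e.1 ∈ S₀)
      simp only [hc] at h1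
      rw [sum_boolSign] at h2
      have key (v : V) : (ℓ v ≤ #{e ∈ S c | e ∈ inc v} ∧ #{e ∈ S c | e ∈ inc v} ≤ u v) ∧
          (ℓ v ≤ #{e ∈ T c | e ∈ inc v} ∧ #{e ∈ T c | e ∈ inc v} ≤ u v) := by
        have i1 := hcount (hI c) (hD c) v
        have i1' := hcount hI₀ hD₀ v
        have i2 := hcm.1 v true
        have i2' := hcm.1 v false
        have i3 := hsum (incD v) c
        have i3' := hsum (incD v) fun e => decide (e.1 ∈ S₀)
        have i4 := hS₀ v
        have i5 := hT₀ v
        have i6 := h v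
        simp only [hc] at i1
        simp only [Bool.not_true, Bool.not_false] at i2 i2'
        lia
      exact ⟨⟨⟨fun v => (key v).1, by lia⟩, fun v => (key v).2, by lia⟩, hI c, hD c⟩
    · intro c _ d _ heq
      funext e
      rw [← hc c, ← hc d, (Prod.mk.inj heq).1]

open Classical in
theorem card_intervalSets_mul_le {inc : V → Finset U} (hinc : ∀ e, #{v | e ∈ inc v} ≤ 2)
    {ℓ u : V → ℕ} (h : ∀ v, ℓ v ≤ u v ∧ u v ≤ ℓ v + 1) {m : ℕ} (hm : 1 ≤ m) :
    #(intervalSets inc ℓ u (m - 1)) * #(intervalSets inc ℓ u (m + 1)) ≤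
      #(intervalSets inc ℓ u m) ^ 2 := by
  rw [sq, ← card_product, ← card_product,
    card_eq_sum_card_fiberwise (f := fun p => (p.1 ∩ p.2, symmDiff p.1 p.2)) (t := univ)
      (fun _ _ => mem_univ _),
    card_eq_sum_card_fiberwise (s := intervalSets inc ℓ u m ×ˢ intervalSets inc ℓ u m)
      (f := fun p => (p.1 ∩ p.2, symmDiff p.1 p.2)) (t := univ) (fun _ _ => mem_univ _)]
  exact sum_le_sum fun x _ => card_fibre_le hinc h hm x.1 x.2

end EdgeSets

section Graphs

open Finset

/-- The non-loop edges on `[n]` that contain the vertex `i`. -/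
def incidentPairs {n : ℕ} (i : Fin n) : Finset {e : Sym2 (Fin n) // ¬ e.IsDiag} :=
  {e | i ∈ e.1}

theorem card_filter_mem_incidentPairs_le {n : ℕ} (e : {e : Sym2 (Fin n) // ¬ e.IsDiag}) :
    #{i | e ∈ incidentPairs i} ≤ 2 := by
  obtain ⟨e, he⟩ := e
  induction e with
  | _ a b =>
    refine (card_le_card (t := {a, b}) fun i hi => ?_).trans card_le_two
    simpa [incidentPairs] using hi

theorem wSeq_eq_card_intervalSets (n : ℕ) (ℓ u : Fin n → ℕ) (m : ℕ) :
    wSeq n ℓ u m = #(intervalSets incidentPairs ℓ u m) := by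
  classical
  let f (G : SimpleGraph (Fin n)) : Finset {e : Sym2 (Fin n) // ¬ e.IsDiag} :=
    {e | e.1 ∈ G.edgeSet}
  have hedge (G : SimpleGraph (Fin n)) : G.edgeSet.ncard = #(f G) := by
    rw [← card_map (Function.Embedding.subtype _), ← Set.ncard_coe_finset]
    congr 1
    ext e
    simpa [f] using G.not_isDiag_of_mem_edgeSet
  have hdeg (G : SimpleGraph (Fin n)) (i : Fin n) :
      degOf G i = #{e ∈ f G | e ∈ incidentPairs i} := by
    rw [degOf, ← Set.ncard_congr' (G.incidenceSetEquivNeighborSet i),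
      ← card_map (Function.Embedding.subtype _), ← Set.ncard_coe_finset]
    congr 1
    ext e
    have := G.not_isDiag_of_mem_edgeSet (e := e)
    simp only [SimpleGraph.incidenceSet, Set.mem_ofPred_eq, f, incidentPairs, coe_map, coe_filter,
      mem_filter, mem_univ, true_and, Function.Embedding.subtype_apply, Set.mem_image,
      Subtype.exists, exists_and_right, exists_eq_right]
    tauto
  rw [wSeq, ← Set.ncard_coe_finset]
  refine Set.ncard_congr (fun G _ => f G) (fun G hG => ?_) (fun G H _ _ h => ?_) (fun S hS => ?_)
  · simpa [intervalSets, hedge, hdeg] using hG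
  · ext a b
    by_cases hab : a = b
    · simp [hab]
    · let e : {e : Sym2 (Fin n) // ¬ e.IsDiag} := ⟨s(a, b), by simpa using hab⟩
      have := congrArg (e ∈ ·) h
      simpa [f, e] using this
  · have hf : f (SimpleGraph.fromEdgeSet (S.map (Function.Embedding.subtype _))) = S := by
      ext ⟨e, he⟩
      simp [f, he]
    refine ⟨_, ?_, hf⟩
    simp only [Set.mem_ofPred_eq, hedge, hdeg, hf]
    simpa [intervalSets] using hS

end Graphs

/-- The sequence `m ↦ |G_m(ℓ,u)|` is log-concave whenever all degree intervals have
size at most one. -/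
theorem logconcave_interval_counts (n : ℕ) (ℓ u : Fin n → ℕ)
    (h : ∀ i, ℓ i ≤ u i ∧ u i ≤ ℓ i + 1) (m : ℕ) (hm : 1 ≤ m) :
    wSeq n ℓ u (m - 1) * wSeq n ℓ u (m + 1) ≤ (wSeq n ℓ u m) ^ 2 := by
  rw [wSeq_eq_card_intervalSets, wSeq_eq_card_intervalSets, wSeq_eq_card_intervalSets]
  exact card_intervalSets_mul_le card_filter_mem_incidentPairs_le h hm
end

section
/- For all fixed reals 0 < α < 1/2 and 0 < ρ < 1 there exists n₁ ∈ ℕ such that the following holds for every n ≥ n₁ and every integer r with 2 ≤ r ≤ (1−ρ)n: for every (α,r)-near-regular degree sequence d ∈ ℕⁿ, every graph G on [n], and all distinct vertices κ, λ such that deg_G(κ) = d_κ + 1, deg_G(λ) = d_λ − 1, and deg_G(i) = dᵢ for all i ∉ {κ,λ}, there exists an alternating (κ,λ)-path in G of length at most 10. (That is, the class of (α,r)-near-regular degree sequences of length at least n₁ is strongly stable with constant k = 10.) -/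
/-- An alternating `(u,v)`-path of length `k` in `G`: a walk `u = p 0, p 1, …, p k = v`
in the complete graph whose consecutive unordered pairs are pairwise distinct and
alternate between edges (at even positions, in particular the first pair) and non-edges
(at odd positions, in particular the last pair) of `G`. -/
def IsAltPath {n : ℕ} (G : SimpleGraph (Fin n)) (u v : Fin n) (k : ℕ) : Prop :=
  0 < k ∧ Even k ∧
    ∃ p : ℕ → Fin n, p 0 = u ∧ p k = v ∧
      (∀ i, i < k → p i ≠ p (i + 1)) ∧
      (∀ i j, i < k → j < k → i ≠ j → s(p i, p (i + 1)) ≠ s(p j, p (j + 1))) ∧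
      (∀ i, i < k → (G.Adj (p i) (p (i + 1)) ↔ Even i))

theorem degOf_eq_degree {n : ℕ} (G : SimpleGraph (Fin n)) [DecidableRel G.Adj] (i : Fin n) :
    degOf G i = G.degree i := by
  rw [degOf, Set.ncard_eq_toFinset_card', SimpleGraph.degree, SimpleGraph.neighborFinset]

theorem isAltPath_two {n : ℕ} {G : SimpleGraph (Fin n)} {u v x : Fin n}
    (hux : G.Adj u x) (hxv : ¬G.Adj x v) (hne : x ≠ v) : IsAltPath G u v 2 := by
  refine ⟨by norm_num, by decide, fun i => if i = 0 then u else if i = 1 then x else v,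
    by simp, by simp, ?_, ?_, ?_⟩
  · intro i hi
    interval_cases i <;> simp [hne, hux.ne]
  · have hux' := hux.symm
    intro i j hi hj hij
    interval_cases i <;> interval_cases j <;>
      simp only [Sym2.eq_iff, ne_eq, reduceIte, Nat.reduceAdd, Nat.reduceEqDiff,
        not_true_eq_false, OfNat.ofNat_ne_zero, one_ne_zero] at hij ⊢ <;>
      grind
  · intro i hi
    interval_cases i <;> simp [hux, hxv]

theorem isAltPath_four {n : ℕ} {G : SimpleGraph (Fin n)} {u v x y z : Fin n}
    (hux : G.Adj u x) (hxy : ¬G.Adj x y) (hne : x ≠ y) (hyz : G.Adj y z)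
    (hzv : ¬G.Adj z v) (hne' : z ≠ v) (hxz : x ≠ z) : IsAltPath G u v 4 := by
  refine ⟨by norm_num, by decide, fun i => if i = 0 then u else if i = 1 then x else
    if i = 2 then y else if i = 3 then z else v, by simp, by simp, ?_, ?_, ?_⟩
  · intro i hi
    interval_cases i <;> simp [hne, hne', hux.ne, hyz.ne]
  · have hux' := hux.symm
    have hyz' := hyz.symm
    have hloop : ¬G.Adj y y := G.loopless.irrefl y
    intro i j hi hj hij
    interval_cases i <;> interval_cases j <;>
      simp only [Sym2.eq_iff, ne_eq, reduceIte, Nat.reduceAdd, Nat.reduceEqDiff,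
        not_true_eq_false, OfNat.ofNat_ne_zero, one_ne_zero] at hij ⊢ <;>
      grind
  · intro i hi
    interval_cases i <;> simp [hux, hxy, hyz, hzv, Nat.even_iff]

/-- A condition on the degrees that forces an alternating `(u,v)`-path of length `2` or `4`: without
one, double counting the edges leaving the non-neighbours of `v` contradicts `h`. -/
theorem exists_isAltPath_of_lt {n : ℕ} (G : SimpleGraph (Fin n)) [DecidableRel G.Adj]
    {u v : Fin n} {m D : ℝ} (hm : ∀ i, i ≠ v → m ≤ G.degree i) (hD : ∀ i, (G.degree i : ℝ) ≤ D)
    (hu : 0 < G.degree u)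
    (h : (D + 1) * (D + 1 - G.degree u) < ((n : ℝ) - 1 - G.degree v) * m) :
    ∃ k, k ≤ 4 ∧ IsAltPath G u v k := by
  by_contra! hno
  have h₂ : ∀ x, G.Adj u x → x ≠ v → G.Adj x v := fun x hx hne => by
    by_contra hxv
    exact hno 2 (by norm_num) (isAltPath_two hx hxv hne)
  let B := Gᶜ.neighborFinset v
  have hB : ∀ z, z ∈ B ↔ z ≠ v ∧ ¬G.Adj z v := fun z => by
    simp [B, SimpleGraph.compl_adj, eq_comm, G.adj_comm]
  let C : Finset (Fin n) := Finset.univ.filter fun y => ∃ z ∈ B, G.Adj y z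
  have hC : ∀ x, G.Adj u x → ∀ y ∈ C, x ≠ y → G.Adj x y := fun x hx y hy hne => by
    obtain ⟨z, hz, hyz⟩ := (Finset.mem_filter.mp hy).2
    obtain ⟨hzne, hzv⟩ := (hB z).mp hz
    by_contra hxy
    refine hno 4 le_rfl (isAltPath_four hx hxy hne hyz hzv hzne ?_)
    rintro rfl
    exact hzv (h₂ x hx hzne)
  have hBcard : (B.card : ℝ) = n - 1 - G.degree v := by
    have h₁ : B.card = Fintype.card (Fin n) - 1 - G.degree v := by
      rw [← G.degree_compl v, SimpleGraph.degree]
    have h₃ := G.degree_lt_card_verts v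
    rw [Fintype.card_fin] at h₁ h₃
    have h₄ : B.card + 1 + G.degree v = n := by omega
    have h₅ : (B.card : ℝ) + 1 + G.degree v = n := mod_cast h₄
    linarith
  have hCcard : (C.card : ℝ) ≤ D + 1 := by
    obtain ⟨x, hx⟩ := (G.degree_pos_iff_exists_adj u).mp hu
    have hsub : C ⊆ insert x (G.neighborFinset x) := fun y hy => by
      by_cases hne : y = x
      · simp [hne]
      · simpa [hne] using hC x hx y hy (Ne.symm hne)
    have hle : C.card ≤ G.degree x + 1 :=
      (Finset.card_le_card hsub).trans (Finset.card_insert_le _ _)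
    have : (C.card : ℝ) ≤ G.degree x + 1 := mod_cast hle
    linarith [hD x]
  have hcount : B.card • m ≤ C.card • (D + 1 - G.degree u) := by
    refine Finset.card_nsmul_le_card_nsmul G.Adj (fun z hz => ?_) (fun y hy => ?_)
    · refine (hm z ((hB z).mp hz).1).trans ?_
      rw [SimpleGraph.degree, Nat.cast_le]
      refine Finset.card_le_card fun y hy => ?_
      rw [SimpleGraph.mem_neighborFinset] at hy
      simpa [Finset.mem_bipartiteAbove, C, hy] using ⟨z, hz, hy.symm⟩
    · have hdisj : Disjoint (Finset.bipartiteBelow G.Adj B y) ((G.neighborFinset u).erase y) := by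
        rw [Finset.disjoint_left]
        intro z hz hz'
        obtain ⟨hzne, hzv⟩ := (hB z).mp ((Finset.mem_bipartiteBelow _).mp hz).1
        exact hzv (h₂ z (by simpa using Finset.mem_of_mem_erase hz') hzne)
      have hsub : Finset.bipartiteBelow G.Adj B y ∪ (G.neighborFinset u).erase y ⊆
          G.neighborFinset y := by
        intro z hz
        rw [SimpleGraph.mem_neighborFinset]
        rcases Finset.mem_union.mp hz with hz | hz
        · exact ((Finset.mem_bipartiteBelow _).mp hz).2.symm
        · obtain ⟨hne, hz⟩ := Finset.mem_erase.mp hz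
          exact (hC z (by simpa using hz) y hy hne).symm
      have hle := Finset.card_le_card hsub
      rw [Finset.card_union_of_disjoint hdisj] at hle
      have herase := Finset.pred_card_le_card_erase (s := G.neighborFinset u) (a := y)
      rw [G.card_neighborFinset_eq_degree] at hle herase
      have : ((Finset.bipartiteBelow G.Adj B y).card : ℝ) + G.degree u ≤ G.degree y + 1 := by
        exact_mod_cast (by omega)
      linarith [hD y]
  rw [nsmul_eq_mul, nsmul_eq_mul, hBcard] at hcount
  have hnonneg : 0 ≤ D + 1 - G.degree u := by linarith [hD u]
  linarith [mul_le_mul_of_nonneg_right hCcard hnonneg]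

/-- Strong stability of near-regular degree sequences with constant `k = 10`:
for every graph realizing a perturbation of a near-regular sequence `d` (one degree
one too high at `κ`, one degree one too low at `λ`), there is an alternating
`(κ,λ)`-path of length at most `10`. -/
theorem near_regular_strongly_stable (α ρ : ℝ) (hα0 : 0 < α) (hα : α < 1 / 2)
    (hρ0 : 0 < ρ) (hρ : ρ < 1) :
    ∃ n₁ : ℕ, ∀ n : ℕ, n₁ ≤ n → ∀ r : ℕ, 2 ≤ r → (r : ℝ) ≤ (1 - ρ) * n →
      ∀ d : Fin n → ℕ, (∀ i, |(d i : ℝ) - (r : ℝ)| ≤ (r : ℝ) ^ α) →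
        ∀ G : SimpleGraph (Fin n), ∀ κ lam : Fin n, κ ≠ lam →
          degOf G κ = d κ + 1 → degOf G lam + 1 = d lam →
          (∀ i, i ≠ κ → i ≠ lam → degOf G i = d i) →
          ∃ k, k ≤ 10 ∧ IsAltPath G κ lam k := by
  classical
  obtain ⟨n₁, hn₁⟩ := exists_nat_gt ((37 / ρ) ^ 2)
  refine ⟨n₁, fun n hn r hr hrn d hd G κ lam hne hκ hlam hrest => ?_⟩
  simp only [degOf_eq_degree] at hκ hlam hrest
  have hn' : (37 / ρ) ^ 2 < (n : ℝ) := hn₁.trans_le (mod_cast hn)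
  have hr' : (2 : ℝ) ≤ r := mod_cast hr
  set t := Real.sqrt r with ht
  set s := Real.sqrt n with hs
  have htr : t ^ 2 = r := Real.sq_sqrt (by linarith)
  have hsn : s ^ 2 = n := Real.sq_sqrt n.cast_nonneg
  have ht0 : 0 ≤ t := Real.sqrt_nonneg _
  have hs0 : 0 ≤ s := Real.sqrt_nonneg _
  have ht1 : 4 / 3 ≤ t := by nlinarith
  have hts : t ≤ s := Real.sqrt_le_sqrt (by nlinarith [n.cast_nonneg (α := ℝ)])
  have hs' : 37 < ρ * s := by
    have : 37 / ρ < s := Real.lt_sqrt_of_sq_lt hn'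
    rwa [div_lt_iff₀' hρ0] at this
  have hpow : (r : ℝ) ^ α ≤ t := by
    rw [ht, Real.sqrt_eq_rpow]
    exact Real.rpow_le_rpow_of_exponent_le (by linarith) hα.le
  have hlow : ∀ i, (r : ℝ) - t ≤ d i := fun i => by
    linarith [(abs_le.mp (hd i)).1]
  have hupp : ∀ i, (d i : ℝ) ≤ r + t := fun i => by
    linarith [(abs_le.mp (hd i)).2]
  have hκ' : (G.degree κ : ℝ) = d κ + 1 := mod_cast hκ
  have hlam' : (G.degree lam : ℝ) + 1 = d lam := mod_cast hlam
  have hrest' : ∀ i, i ≠ κ → i ≠ lam → (G.degree i : ℝ) = d i := fun i h₁ h₂ =>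
    mod_cast hrest i h₁ h₂
  have hmin : ∀ i, i ≠ lam → (r : ℝ) - t ≤ G.degree i := fun i hi => by
    by_cases h : i = κ
    · subst h
      linarith [hlow i]
    · rw [hrest' i h hi]
      exact hlow i
  have hmax : ∀ i, (G.degree i : ℝ) ≤ r + t + 1 := fun i => by
    by_cases h : i = κ
    · subst h
      linarith [hupp i]
    · by_cases h' : i = lam
      · subst h'
        linarith [hupp i]
      · linarith [hrest' i h h', hupp i]
  have hquarter : (r : ℝ) / 4 ≤ r - t := by nlinarith
  have hlt : (r + t + 1 + 1) * (r + t + 1 + 1 - (G.degree κ : ℝ)) <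
      ((n : ℝ) - 1 - G.degree lam) * (r - t) := by
    calc (r + t + 1 + 1) * (r + t + 1 + 1 - (G.degree κ : ℝ))
        ≤ (3 * r) * (3 * t) := by
          gcongr
          · linarith [hmax κ]
          · nlinarith
          · linarith [hlow κ]
      _ = 36 * t * (r / 4) := by ring
      _ < (ρ * n - t) * (r / 4) := by
          gcongr
          nlinarith
      _ ≤ ((n : ℝ) - 1 - G.degree lam) * (r - t) := by
          have : ρ * n - t ≤ (n : ℝ) - 1 - G.degree lam := by linarith [hupp lam]
          refine mul_le_mul this hquarter (by positivity) (le_trans ?_ this)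
          nlinarith
  obtain ⟨k, hk, hpath⟩ := exists_isAltPath_of_lt G hmin hmax (by omega) hlt
  exact ⟨k, by omega, hpath⟩
end

section
/- For all fixed reals 0 < α < 1/2 and 0 < ρ < 1 there exists n₁ ∈ ℕ such that for every n ≥ n₁, every integer r with 2 ≤ r ≤ (1−ρ)n, every (α,r)-near-regular degree sequence d ∈ ℕⁿ, every graph G ∈ G(d), and every edge {u,v} ∈ E(G), there exists a graph G' ∈ G(d) with {u,v} ∉ E(G') and |E(G) △ E(G')| ≤ 12, where △ denotes symmetric difference of edge sets. -/
/-- `Gd n d` is the set of graphs on `[n]` with degree sequence `d`. -/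
def Gd (n : ℕ) (d : Fin n → ℕ) : Set (SimpleGraph (Fin n)) :=
  {G | ∀ i, degOf G i = d i}

open Finset in
/-- A graph obtained by exchanging a set `R` of edges for a set `D` of non-edges which covers every
vertex equally often has the same degrees. -/
theorem exists_graph_of_balanced_exchange {n : ℕ} (G : SimpleGraph (Fin n))
    (R D : Finset (Sym2 (Fin n))) (hR : ∀ e ∈ R, e ∈ G.edgeSet) (hD : ∀ e ∈ D, e ∉ G.edgeSet)
    (hdiag : ∀ e ∈ D, ¬ e.IsDiag)
    (hbal : ∀ i, #{e ∈ R | i ∈ e} = #{e ∈ D | i ∈ e}) :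
    ∃ G' : SimpleGraph (Fin n), (∀ i, degOf G' i = degOf G i) ∧ (∀ e ∈ R, e ∉ G'.edgeSet) ∧
      symmDiff G.edgeSet G'.edgeSet = ↑(R ∪ D) := by
  classical
  have hE : (SimpleGraph.fromEdgeSet (G.edgeSet \ ↑R ∪ ↑D)).edgeSet = G.edgeSet \ ↑R ∪ ↑D := by
    rw [SimpleGraph.edgeSet_fromEdgeSet, sdiff_eq_left, Set.disjoint_left]
    rintro e (he | he)
    · exact G.not_isDiag_of_mem_edgeSet he.1
    · exact hdiag e he
  refine ⟨SimpleGraph.fromEdgeSet (G.edgeSet \ ↑R ∪ ↑D), fun i => ?_, fun e he => ?_, ?_⟩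
  · let I (H : SimpleGraph (Fin n)) : Finset (Sym2 (Fin n)) := {e | e ∈ H.edgeSet ∧ i ∈ e}
    have hdeg (H : SimpleGraph (Fin n)) : degOf H i = #(I H) := by
      have h1 : degOf H i = H.degree i := by
        rw [degOf, Set.ncard_eq_toFinset_card']
        rfl
      rw [h1, ← SimpleGraph.card_incidenceFinset_eq_degree]
      congr 1
      ext e
      simp [I, SimpleGraph.incidenceSet]
    rw [hdeg, hdeg]
    have h1 : I (SimpleGraph.fromEdgeSet (G.edgeSet \ ↑R ∪ ↑D)) =
        (I G \ ({e ∈ R | i ∈ e} : Finset _)) ∪ ({e ∈ D | i ∈ e} : Finset _) := by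
      ext e
      simp only [I, hE, mem_filter, mem_univ, true_and, mem_union, mem_sdiff, Set.mem_union,
        Set.mem_sdiff, mem_coe]
      tauto
    have hsub : ({e ∈ R | i ∈ e} : Finset _) ⊆ I G := by
      intro e he
      simp only [I, mem_filter, mem_univ, true_and] at he ⊢
      exact ⟨hR e he.1, he.2⟩
    rw [h1, card_union_of_disjoint, card_sdiff_of_subset hsub, ← hbal]
    · exact Nat.sub_add_cancel (card_le_card hsub)
    · rw [Finset.disjoint_left]
      intro e he he'
      simp only [I, mem_filter, mem_univ, true_and, mem_sdiff] at he he'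
      exact hD e he'.1 he.1.1
  · rw [hE]
    rintro (h | h)
    · exact h.2 he
    · exact hD e h (hR e he)
  · rw [hE]
    ext e
    have h1 := hR e
    have h2 := hD e
    simp only [Set.mem_symmDiff, Set.mem_union, Set.mem_sdiff, mem_coe, coe_union]
    tauto

/-- Removing an edge by a switch along an alternating closed walk of length four. -/
theorem exists_switch_four {n : ℕ} (G : SimpleGraph (Fin n)) {u v x y : Fin n}
    (huv : G.Adj u v) (hxy : G.Adj x y) (hxu : x ≠ u) (hux : ¬ G.Adj u x)
    (hyv : y ≠ v) (hvy : ¬ G.Adj v y) :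
    ∃ G' : SimpleGraph (Fin n), (∀ i, degOf G' i = degOf G i) ∧ ¬ G'.Adj u v ∧
      (symmDiff G.edgeSet G'.edgeSet).ncard ≤ 12 := by
  classical
  have huv' := huv.ne
  have hxy' := hxy.ne
  have hxv : x ≠ v := by rintro rfl; exact hux huv
  have hyu : y ≠ u := by rintro rfl; exact hvy huv.symm
  obtain ⟨G', h1, h2, h3⟩ := exists_graph_of_balanced_exchange G
    {s(u, v), s(x, y)} {s(u, x), s(v, y)} (by simp [huv, hxy]) (by simp [hux, hvy])
    (by simp [hxu.symm, hyv.symm]) (fun i => by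
      rw [Finset.card_filter, Finset.card_filter, Finset.sum_pair, Finset.sum_pair]
      · simp only [Sym2.mem_iff]
        grind
      · simp [huv', hyu.symm]
      · simp [hxu.symm, hyu.symm])
  refine ⟨G', h1, h2 s(u, v) (by simp), ?_⟩
  rw [h3, Set.ncard_coe_finset]
  refine (Finset.card_union_le _ _).trans ?_
  exact (add_le_add Finset.card_le_two Finset.card_le_two).trans (by norm_num)

/-- Removing an edge by a switch along an alternating closed walk of length six, which may revisit
vertices. -/
theorem exists_switch_six {n : ℕ} (G : SimpleGraph (Fin n)) {u v a x y b : Fin n}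
    (huv : G.Adj u v) (hax : G.Adj a x) (hyb : G.Adj y b) (hau : a ≠ u) (hua : ¬ G.Adj u a)
    (hxy : x ≠ y) (hxy' : ¬ G.Adj x y) (hbv : b ≠ v) (hvb : ¬ G.Adj v b)
    (hay : a ≠ y) :
    ∃ G' : SimpleGraph (Fin n), (∀ i, degOf G' i = degOf G i) ∧ ¬ G'.Adj u v ∧
      (symmDiff G.edgeSet G'.edgeSet).ncard ≤ 12 := by
  classical
  have huv' := huv.ne
  have hax' := hax.ne
  have hyb' := hyb.ne
  have hav : a ≠ v := by rintro rfl; exact hua huv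
  have hbu : b ≠ u := by rintro rfl; exact hvb huv.symm
  have hxu : x ≠ u := by rintro rfl; exact hua hax.symm
  have hyv : y ≠ v := by rintro rfl; exact hvb hyb
  have sum_three (f : Sym2 (Fin n) → ℕ) {p q r : Sym2 (Fin n)} (hpq : p ≠ q) (hpr : p ≠ r)
      (hqr : q ≠ r) : ∑ e ∈ {p, q, r}, f e = f p + (f q + f r) := by
    rw [Finset.sum_insert (by simp [hpq, hpr]), Finset.sum_pair hqr]
  obtain ⟨G', h1, h2, h3⟩ := exists_graph_of_balanced_exchange G
    {s(u, v), s(a, x), s(y, b)} {s(u, a), s(x, y), s(v, b)} (by simp [huv, hax, hyb])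
    (by simp [hua, hvb, hxy']) (by simp [hau.symm, hbv.symm, hxy]) (fun i => by
      rw [Finset.card_filter, Finset.card_filter, sum_three, sum_three]
      · simp only [Sym2.mem_iff]
        grind
      all_goals
        simp only [ne_eq, Sym2.eq_iff]
        grind)
  refine ⟨G', h1, h2 s(u, v) (by simp), ?_⟩
  rw [h3, Set.ncard_coe_finset]
  refine (Finset.card_union_le _ _).trans ?_
  exact (add_le_add Finset.card_le_three Finset.card_le_three).trans (by norm_num)

open Finset in
/-- If all degrees lie in `[lo, hi]` and neither a four- nor a six-switch removes the edge `uv`,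
then `hi - lo` is large. -/
theorem exists_removal_of_degree_bounds {n : ℕ} (G : SimpleGraph (Fin n)) {u v : Fin n}
    (huv : G.Adj u v) {lo hi : ℝ} (hlo0 : 0 ≤ lo) (hlo : ∀ i, lo ≤ degOf G i)
    (hhi : ∀ i, (degOf G i : ℝ) ≤ hi) (hn : hi + 1 < n)
    (hlt : (hi + 1) * (hi - lo + 1) < (n - hi - 1) * lo) :
    ∃ G' : SimpleGraph (Fin n), (∀ i, degOf G' i = degOf G i) ∧ ¬ G'.Adj u v ∧
      (symmDiff G.edgeSet G'.edgeSet).ncard ≤ 12 := by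
  classical
  by_contra hno
  have h4 : ∀ x y, G.Adj x y → x ≠ u → ¬ G.Adj u x → y ≠ v → ¬ G.Adj v y → False :=
    fun x y h1 h2 h3 h4 h5 => hno (exists_switch_four G huv h1 h2 h3 h4 h5)
  have h6 : ∀ a x y b, G.Adj a x → G.Adj y b → a ≠ u → ¬ G.Adj u a → x ≠ y → ¬ G.Adj x y →
      b ≠ v → ¬ G.Adj v b → a ≠ y → False :=
    fun a x y b h1 h2 h3 h4 h5 h6 h7 h8 h9 =>
      hno (exists_switch_six G huv h1 h2 h3 h4 h5 h6 h7 h8 h9)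
  clear hno
  have hdeg (i : Fin n) : degOf G i = #(G.neighborFinset i) := by
    rw [degOf, Set.ncard_eq_toFinset_card']
    rfl
  simp only [hdeg] at hlo hhi
  let A (w : Fin n) : Finset (Fin n) := (insert w (G.neighborFinset w))ᶜ
  have memA {w x : Fin n} : x ∈ A w ↔ x ≠ w ∧ ¬ G.Adj w x := by simp [A]
  let N (w : Fin n) : Finset (Fin n) := {x | ∃ a ∈ A w, G.Adj a x}
  have memN {w x : Fin n} : x ∈ N w ↔ ∃ a, (a ≠ w ∧ ¬ G.Adj w a) ∧ G.Adj a x := by simp [N, memA]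
  have cardA (w : Fin n) : (n : ℝ) - hi - 1 ≤ #(A w) := by
    have h1 : #(A w) + #(insert w (G.neighborFinset w)) = n := by
      rw [add_comm, card_add_card_compl, Fintype.card_fin]
    have h2 := card_insert_le w (G.neighborFinset w)
    have h3 : (n : ℝ) ≤ #(A w) + (#(G.neighborFinset w) + 1) := by
      exact_mod_cast (by omega : n ≤ #(A w) + (#(G.neighborFinset w) + 1))
    linarith [hhi w]
  have hNu : N u ⊆ insert v (G.neighborFinset v) := by
    intro x hx
    obtain ⟨a, ha, hax⟩ := memN.1 hx
    by_contra h
    simp only [mem_insert, SimpleGraph.mem_neighborFinset, not_or] at h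
    exact h4 a x hax ha.1 ha.2 h.1 h.2
  have cardNu : (#(N u) : ℝ) ≤ hi + 1 := by
    have h1 : #(N u) ≤ #(G.neighborFinset v) + 1 :=
      (card_le_card hNu).trans (card_insert_le _ _)
    have h2 : (#(N u) : ℝ) ≤ #(G.neighborFinset v) + 1 := by exact_mod_cast h1
    linarith [hhi v]
  have cardNv : lo ≤ #(N v) := by
    have hpos : 0 < #(A v) := by
      have h : (0 : ℝ) < #(A v) := by linarith [cardA v]
      exact_mod_cast h
    obtain ⟨b, hb⟩ := card_pos.1 hpos
    have h1 : G.neighborFinset b ⊆ N v := fun x hx =>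
      memN.2 ⟨b, memA.1 hb, by simpa using hx⟩
    have h2 : (#(G.neighborFinset b) : ℝ) ≤ #(N v) := by exact_mod_cast card_le_card h1
    linarith [hlo b]
  have degA (x : Fin n) (hx : x ∈ N u) : (#{a ∈ A u | G.Adj a x} : ℝ) ≤ hi - lo + 1 := by
    obtain ⟨a, ha, hax⟩ := memN.1 hx
    have hdisj {y : Fin n} (hy : y ∈ N v) (hyA : y ≠ u ∧ ¬ G.Adj u y) : False := by
      obtain ⟨b, hb, hby⟩ := memN.1 hy
      exact h4 y b hby.symm hyA.1 hyA.2 hb.1 hb.2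
    have h1 : ({a ∈ A u | G.Adj a x} : Finset _) ∪ (N v).erase x ⊆ G.neighborFinset x := by
      intro y hy
      simp only [mem_union, mem_filter, mem_erase, SimpleGraph.mem_neighborFinset] at hy ⊢
      rcases hy with hy | ⟨hyx, hy⟩
      · exact hy.2.symm
      · by_contra hxy
        obtain ⟨b, hb, hby⟩ := memN.1 hy
        refine h6 a x y b hax hby.symm ha.1 ha.2 (Ne.symm hyx) hxy hb.1 hb.2 ?_
        rintro rfl
        exact hdisj hy ha
    have h2 : Disjoint ({a ∈ A u | G.Adj a x} : Finset _) ((N v).erase x) := by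
      rw [Finset.disjoint_left]
      intro y hy hy'
      exact hdisj (mem_of_mem_erase hy') (memA.1 (mem_filter.1 hy).1)
    have h3 := card_le_card h1
    rw [card_union_of_disjoint h2] at h3
    have h4 := pred_card_le_card_erase (s := N v) (a := x)
    have h5 : (#{a ∈ A u | G.Adj a x} : ℝ) + #(N v) ≤ #(G.neighborFinset x) + 1 := by
      exact_mod_cast (by omega :
        #{a ∈ A u | G.Adj a x} + #(N v) ≤ #(G.neighborFinset x) + 1)
    linarith [hhi x]
  have hcount : ∑ a ∈ A u, #(G.neighborFinset a) = ∑ x ∈ N u, #{a ∈ A u | G.Adj a x} := by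
    have h := sum_card_bipartiteAbove_eq_sum_card_bipartiteBelow (s := A u) (t := N u) G.Adj
    refine Eq.trans (sum_congr rfl fun a ha => ?_) h
    congr 1
    ext x
    simp only [bipartiteAbove, mem_filter, SimpleGraph.mem_neighborFinset]
    exact ⟨fun hx => ⟨memN.2 ⟨a, memA.1 ha, hx⟩, hx⟩, fun hx => hx.2⟩
  have hcount' : ∑ a ∈ A u, (#(G.neighborFinset a) : ℝ) =
      ∑ x ∈ N u, (#{a ∈ A u | G.Adj a x} : ℝ) := by exact_mod_cast hcount
  have hlower : #(A u) * lo ≤ ∑ a ∈ A u, (#(G.neighborFinset a) : ℝ) := by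
    simpa using card_nsmul_le_sum (A u) (fun a => (#(G.neighborFinset a) : ℝ)) lo
      fun a _ => hlo a
  have hupper : ∑ x ∈ N u, (#{a ∈ A u | G.Adj a x} : ℝ) ≤ #(N u) * (hi - lo + 1) := by
    simpa only [nsmul_eq_mul] using sum_le_card_nsmul (N u) (fun x => (#{a ∈ A u | G.Adj a x} : ℝ)) _ degA
  have hgap : 0 ≤ hi - lo + 1 := by linarith [hlo u, hhi u]
  have h1 := mul_le_mul_of_nonneg_right cardNu hgap
  have h2 := mul_le_mul_of_nonneg_right (cardA u) hlo0
  linarith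

/-- For near-regular degree sequences: any edge of a realization can be removed while
staying within symmetric difference `12` of the original realization. -/
theorem remove_edge_close_realization (α ρ : ℝ) (hα0 : 0 < α) (hα : α < 1 / 2)
    (hρ0 : 0 < ρ) (hρ : ρ < 1) :
    ∃ n₁ : ℕ, ∀ n : ℕ, n₁ ≤ n → ∀ r : ℕ, 2 ≤ r → (r : ℝ) ≤ (1 - ρ) * n →
      ∀ d : Fin n → ℕ, (∀ i, |(d i : ℝ) - (r : ℝ)| ≤ (r : ℝ) ^ α) →
        ∀ G ∈ Gd n d, ∀ u v : Fin n, G.Adj u v →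
          ∃ G' ∈ Gd n d, ¬ G'.Adj u v ∧ (symmDiff G.edgeSet G'.edgeSet).ncard ≤ 12 := by
  refine ⟨⌈(100 / ρ) ^ 2⌉₊, fun n hn r hr hrn d hd G hG u v huv => ?_⟩
  have hdeg : ∀ i, degOf G i = d i := hG
  have hr2 : (2 : ℝ) ≤ r := by exact_mod_cast hr
  have hpow : (r : ℝ) ^ α ≤ √r := by
    rw [Real.sqrt_eq_rpow]
    exact Real.rpow_le_rpow_of_exponent_le (by linarith) hα.le
  have hd' (i : Fin n) : |(d i : ℝ) - r| ≤ √r := (hd i).trans hpow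
  set s := √(r : ℝ) with hs
  set m := √(n : ℝ) with hm
  have hss : s * s = r := Real.mul_self_sqrt (by linarith)
  have hmm : m * m = n := Real.mul_self_sqrt (Nat.cast_nonneg n)
  have hm100 : 100 ≤ ρ * m := by
    have h : 100 / ρ ≤ m := Real.le_sqrt_of_sq_le (Nat.ceil_le.1 hn)
    rwa [div_le_iff₀ hρ0, mul_comm] at h
  have hs1 : 4 / 3 ≤ s := Real.le_sqrt_of_sq_le (by linarith)
  have hm0 : 0 < m := by nlinarith
  have hsm : s ≤ m := Real.sqrt_le_sqrt (by nlinarith)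
  have hm1 : 1 ≤ m := by nlinarith
  have hρn : 100 * m ≤ ρ * n := by nlinarith
  have hspace : 98 * m ≤ n - (s * s + s) - 1 := by nlinarith
  obtain ⟨G', h1, h2, h3⟩ := exists_removal_of_degree_bounds G huv (lo := r - s) (hi := r + s)
    (by nlinarith)
    (fun i => by rw [hdeg]; linarith [(abs_le.1 (hd' i)).1])
    (fun i => by rw [hdeg]; linarith [(abs_le.1 (hd' i)).2])
    (by nlinarith)
    (by
      rw [← hss]
      have hleft : (s * s + s + 1) * (s * s + s - (s * s - s) + 1) ≤ (3 * (s * s)) * (3 * s) :=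
        mul_le_mul (by nlinarith) (by linarith) (by linarith) (by positivity)
      have hright : (98 * m) * ((1 / 4) * (s * s)) ≤
          (n - (s * s + s) - 1) * (s * s - s) :=
        mul_le_mul hspace (by nlinarith) (by positivity) (by nlinarith)
      have hmid : s * s * s ≤ m * (s * s) := by nlinarith [mul_self_nonneg s]
      have hpos : 0 < m * (s * s) := by positivity
      linarith)
  exact ⟨G', fun i => (h1 i).trans (hdeg i), h2, h3⟩
end

section
/- For all fixed reals 0 < α < 1/2 and 0 < ρ < 1 there exists n₁ ∈ ℕ such that for every n ≥ n₁, every integer r with 2 ≤ r ≤ (1−ρ)n, every (α,r)-near-regular degree sequence d ∈ ℕⁿ, every graph G ∈ G(d), and all edges {u,w}, {u,v} ∈ E(G) with v ≠ w, there exists a graph G' ∈ G(d) with {u,w} ∈ E(G'), {u,v} ∉ E(G'), and |E(G) △ E(G')| ≤ 12, where △ denotes symmetric difference of edge sets. -/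
/-- Replacing the edges `pq`, `xy` by the non-edges `qx`, `yp` preserves all degrees. -/
theorem exists_switch {n : ℕ} (G : SimpleGraph (Fin n)) {p q x y : Fin n}
    (hpq : G.Adj p q) (hxy : G.Adj x y) (hqx : ¬ G.Adj q x) (hyp : ¬ G.Adj y p)
    (hqx' : q ≠ x) (hyp' : y ≠ p) :
    ∃ G' : SimpleGraph (Fin n), (∀ i, degOf G' i = degOf G i) ∧
      (∀ i j, G'.Adj i j ↔ (G.Adj i j ∧ s(i, j) ≠ s(p, q) ∧ s(i, j) ≠ s(x, y)) ∨
        s(i, j) = s(q, x) ∨ s(i, j) = s(y, p)) ∧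
      (symmDiff G.edgeSet G'.edgeSet).ncard ≤ 4 := by
  have hpx : p ≠ x := by rintro rfl; exact hqx hpq.symm
  have hqy : q ≠ y := by rintro rfl; exact hyp hpq.symm
  have hpq' := hpq.ne
  have hxy' := hxy.ne
  let G' : SimpleGraph (Fin n) :=
    { Adj := fun i j => (G.Adj i j ∧ s(i, j) ≠ s(p, q) ∧ s(i, j) ≠ s(x, y)) ∨
        s(i, j) = s(q, x) ∨ s(i, j) = s(y, p)
      symm := ⟨fun i j h => by rwa [Sym2.eq_swap, G.adj_comm]⟩
      loopless := ⟨fun i h => by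
        simp only [SimpleGraph.irrefl, false_and, false_or, Sym2.eq_iff] at h
        grind⟩ }
  have hadj : ∀ i j, G'.Adj i j ↔ (G.Adj i j ∧ s(i, j) ≠ s(p, q) ∧ s(i, j) ≠ s(x, y)) ∨
        s(i, j) = s(q, x) ∨ s(i, j) = s(y, p) := fun _ _ => Iff.rfl
  refine ⟨G', fun i => ?_, hadj, ?_⟩
  · have exchange : ∀ a b, ¬ G.Adj i a → G.Adj i b →
        (∀ j, G'.Adj i j ↔ j = a ∨ (G.Adj i j ∧ j ≠ b)) → degOf G' i = degOf G i := by
      intro a b ha hb h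
      have : G'.neighborSet i = insert a (G.neighborSet i \ {b}) := by
        ext j
        simpa using h j
      rw [degOf, degOf, this]
      exact Set.ncard_exchange ha hb
    have hsymm := G.adj_comm
    simp only [Sym2.eq_iff, ne_eq] at hadj
    by_cases hp : i = p
    · exact exchange y q (by grind) (by grind) (by grind)
    by_cases hq : i = q
    · exact exchange x p (by grind) (by grind) (by grind)
    by_cases hx : i = x
    · exact exchange q y (by grind) (by grind) (by grind)
    by_cases hy : i = y
    · exact exchange p x (by grind) (by grind) (by grind)
    have : G'.neighborSet i = G.neighborSet i := by
      ext j
      simp only [SimpleGraph.mem_neighborSet]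
      grind
    rw [degOf, degOf, this]
  · have hsub : symmDiff G.edgeSet G'.edgeSet ⊆
        (({s(p, q), s(x, y), s(q, x), s(y, p)} : Finset (Sym2 (Fin n))) : Set _) := by
      intro e
      induction e with
      | _ i j =>
        simp only [Set.mem_symmDiff, SimpleGraph.mem_edgeSet, hadj, Finset.coe_insert,
          Finset.coe_singleton, Set.mem_insert_iff, Set.mem_singleton_iff]
        tauto
    refine (Set.ncard_le_ncard hsub (Finset.finite_toSet _)).trans ?_
    rw [Set.ncard_coe_finset]
    exact Finset.card_le_four

/-- Edge distances of graphs satisfy the triangle inequality. -/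
theorem ncard_symmDiff_edgeSet_le {n : ℕ} (G H K : SimpleGraph (Fin n)) :
    (symmDiff G.edgeSet K.edgeSet).ncard ≤
      (symmDiff G.edgeSet H.edgeSet).ncard + (symmDiff H.edgeSet K.edgeSet).ncard :=
  (Set.ncard_le_ncard (symmDiff_triangle _ _ _) (Set.toFinite _)).trans (Set.ncard_union_le _ _)

/-- A walk `u v x y z t` alternating between edges and non-edges with `x` and `t` distinct and
non-adjacent yields a degree-preserving change that removes `uv`. -/
theorem exists_hexagon_switch {n : ℕ} (G : SimpleGraph (Fin n)) {u v w x y z t : Fin n}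
    (hvw : v ≠ w) (huw : G.Adj u w) (huv : G.Adj u v) (hvx : ¬ G.Adj v x) (hvx' : v ≠ x)
    (hxy : G.Adj x y) (hyz : ¬ G.Adj y z) (hyz' : y ≠ z) (hzt : G.Adj z t) (htu : ¬ G.Adj t u)
    (htu' : t ≠ u) (htx : ¬ G.Adj t x) (htx' : t ≠ x) (hyu : y ≠ u) (hzu : z ≠ u)
    (hyv : y ≠ v) (hzv : z ≠ v) :
    ∃ G' : SimpleGraph (Fin n), (∀ i, degOf G' i = degOf G i) ∧ G'.Adj u w ∧ ¬ G'.Adj u v ∧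
      (symmDiff G.edgeSet G'.edgeSet).ncard ≤ 12 := by
  have hsymm := G.adj_comm
  have hne : ∀ i j, G.Adj i j → i ≠ j := fun _ _ h => h.ne
  obtain ⟨H, hHdeg, hHadj, hHcard⟩ := exists_switch G hxy hzt hyz htx hyz' htx'
  simp only [Sym2.eq_iff, ne_eq] at hHadj
  obtain ⟨K, hKdeg, hKadj, hKcard⟩ := exists_switch H (p := u) (q := v) (x := x) (y := t)
    (by grind) (by grind) (by grind) (by grind) hvx' htu'
  simp only [Sym2.eq_iff, ne_eq] at hKadj
  refine ⟨K, fun i => (hKdeg i).trans (hHdeg i), by grind, by grind, ?_⟩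
  have := ncard_symmDiff_edgeSet_le G H K
  omega

/-- Two non-adjacent common neighbours `y`, `z` of a vertex `x` outside the neighbourhoods of
`u` and `v`, with `y` adjacent to `u`, yield a degree-preserving change that removes `uv`. -/
theorem exists_bowtie_switch {n : ℕ} (G : SimpleGraph (Fin n)) {u v w x y z : Fin n}
    (hvw : v ≠ w) (huw : G.Adj u w) (huv : G.Adj u v) (hvx : ¬ G.Adj v x) (hvx' : v ≠ x)
    (hux : ¬ G.Adj u x) (hux' : u ≠ x) (hxy : G.Adj x y) (hxz : G.Adj x z)
    (hyz : ¬ G.Adj y z) (hyz' : y ≠ z) (huy : G.Adj u y) :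
    ∃ G' : SimpleGraph (Fin n), (∀ i, degOf G' i = degOf G i) ∧ G'.Adj u w ∧ ¬ G'.Adj u v ∧
      (symmDiff G.edgeSet G'.edgeSet).ncard ≤ 12 := by
  have hsymm := G.adj_comm
  have hne : ∀ i j, G.Adj i j → i ≠ j := fun _ _ h => h.ne
  obtain ⟨H, hHdeg, hHadj, hHcard⟩ := exists_switch G huy hxz.symm hyz
    (fun h => hux h.symm) hyz' hux'.symm
  simp only [Sym2.eq_iff, ne_eq] at hHadj
  obtain ⟨K, hKdeg, hKadj, hKcard⟩ := exists_switch H (p := u) (q := v) (x := x) (y := y)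
    (by grind) (by grind) (by grind) (by grind) hvx' (by grind)
  simp only [Sym2.eq_iff, ne_eq] at hKadj
  refine ⟨K, fun i => (hKdeg i).trans (hHdeg i), by grind, by grind, ?_⟩
  have := ncard_symmDiff_edgeSet_le G H K
  omega

/-- The closed neighbourhood of `u` has at most `b + 1` vertices. -/
theorem card_insert_neighborFinset_le {n b : ℕ} (G : SimpleGraph (Fin n)) [DecidableRel G.Adj]
    (hb : ∀ i, G.degree i ≤ b) (u : Fin n) : (insert u (G.neighborFinset u)).card ≤ b + 1 :=
  (Finset.card_insert_le _ _).trans (Nat.succ_le_succ (hb u))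

/-- The removal of `uv` is possible under numerical conditions on the degree range `[a, b]`. -/
theorem exists_graph_remove_edge {n a b : ℕ} (G : SimpleGraph (Fin n)) [DecidableRel G.Adj]
    (ha : ∀ i, a ≤ G.degree i) (hb : ∀ i, G.degree i ≤ b)
    (hn : 2 * (b + 1) < n + a)
    (hcount : (b + 1) * b < (n - (b + 1)) * a ∨
      b * (b + 1 - a) < (n - (b + 1)) * (2 * a - (b + 1)))
    {u v w : Fin n} (hvw : v ≠ w) (huw : G.Adj u w) (huv : G.Adj u v) :
    ∃ G' : SimpleGraph (Fin n), (∀ i, degOf G' i = degOf G i) ∧ G'.Adj u w ∧ ¬ G'.Adj u v ∧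
      (symmDiff G.edgeSet G'.edgeSet).ncard ≤ 12 := by
  classical
  have hsymm := G.adj_comm
  have hne : ∀ i j, G.Adj i j → i ≠ j := fun _ _ h => h.ne
  by_contra hno
  have hab : a ≤ b := (ha u).trans (hb u)
  have hclosed := card_insert_neighborFinset_le G hb
  set F : Fin n → Finset (Fin n) := fun i => (insert i (G.neighborFinset i))ᶜ with hF
  have hmem : ∀ i j, j ∈ F i ↔ j ≠ i ∧ ¬ G.Adj i j := by
    intro i j
    simp [hF]
  have hFcard : ∀ i, n - (b + 1) ≤ (F i).card := by
    intro i
    have := hclosed i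
    rw [hF, Finset.card_compl, Fintype.card_fin]
    omega
  have hsep : ∀ x ∈ F v, ∀ y ∈ F u, ¬ G.Adj x y := by
    intro x hx y hy hxy
    rw [hmem] at hx hy
    obtain ⟨H, hHdeg, hHadj, hHcard⟩ := exists_switch G huv hxy hx.2
      (fun h => hy.2 h.symm) hx.1.symm hy.1
    simp only [Sym2.eq_iff, ne_eq] at hHadj
    exact hno ⟨H, hHdeg, by grind, by grind, by omega⟩
  have hnbr : ∀ x ∈ F v, G.neighborFinset x ⊆ insert u (G.neighborFinset u) := by
    intro x hx y hy
    by_contra h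
    exact hsep x hx y (Finset.mem_compl.2 h) (by simpa using hy)
  by_cases hI : ∃ x, x ∈ F v ∧ x ∈ F u
  · obtain ⟨x, hxv, hxu⟩ := hI
    have hxv' := (hmem v x).1 hxv
    have hxu' := (hmem u x).1 hxu
    have hclique : ∀ y z, G.Adj x y → G.Adj x z → y ≠ z → G.Adj y z := by
      intro y z hy hz hyz
      by_contra hyz'
      have huy := hnbr x hxv (by simpa using hy)
      rw [Finset.mem_insert, SimpleGraph.mem_neighborFinset] at huy
      exact hno (exists_bowtie_switch G hvw huw huv hxv'.2 hxv'.1.symm hxu'.2 hxu'.1.symm hy hz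
        hyz' hyz (by grind))
    rcases hcount with hcount | hcount
    · have key := Finset.card_mul_le_card_mul (s := F v) (t := insert u (G.neighborFinset u))
        (m := a) (n := b) G.Adj
        (fun x' hx' => (ha x').trans (Finset.card_le_card fun y hy =>
          Finset.mem_filter.2 ⟨hnbr x' hx' hy, by simpa using hy⟩))
        (fun y _ => (Finset.card_le_card fun z hz => by
          simpa using (Finset.mem_filter.1 hz).2.symm).trans (hb y))
      have h1 := Nat.mul_le_mul_right a (hFcard v)
      have h2 := Nat.mul_le_mul_right b (hclosed u)
      omega
    · have key := Finset.card_mul_le_card_mul (s := F v) (t := G.neighborFinset x)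
        (m := 2 * a - (b + 1)) (n := b + 1 - a) G.Adj
        (fun x' hx' => by
          have h1 := Finset.card_union_add_card_inter (G.neighborFinset x') (G.neighborFinset x)
          have h2 := Finset.card_le_card (Finset.union_subset (hnbr x' hx') (hnbr x hxv))
          have h3 : G.neighborFinset x' ∩ G.neighborFinset x ⊆
              (G.neighborFinset x).bipartiteAbove G.Adj x' := by
            intro y hy
            rw [Finset.mem_inter] at hy
            exact Finset.mem_filter.2 ⟨hy.2, by simpa using hy.1⟩
          have h4 := Finset.card_le_card h3
          have h5 := hclosed u
          have h6 : a ≤ (G.neighborFinset x').card := ha x'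
          have h7 : a ≤ (G.neighborFinset x).card := ha x
          omega)
        (fun y hy => by
          rw [SimpleGraph.mem_neighborFinset] at hy
          have hdisj : Disjoint ((F v).bipartiteBelow G.Adj y)
              ((G.neighborFinset x).erase y) := by
            rw [Finset.disjoint_left]
            intro z hz hz'
            exact hsep z (Finset.mem_filter.1 hz).1 x hxu
              (by simpa using (Finset.mem_erase.1 hz').2 : G.Adj x z).symm
          have hsub : (F v).bipartiteBelow G.Adj y ∪ (G.neighborFinset x).erase y ⊆
              G.neighborFinset y := by
            intro z hz
            rw [SimpleGraph.mem_neighborFinset]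
            rcases Finset.mem_union.1 hz with hz | hz
            · exact (Finset.mem_filter.1 hz).2.symm
            · rw [Finset.mem_erase, SimpleGraph.mem_neighborFinset] at hz
              exact hclique y z hy hz.2 hz.1.symm
          have h1 := Finset.card_le_card hsub
          rw [Finset.card_union_of_disjoint hdisj,
            Finset.card_erase_of_mem (by simpa using hy)] at h1
          have h2 : a ≤ (G.neighborFinset x).card := ha x
          have h3 : (G.neighborFinset y).card ≤ b := hb y
          omega)
      have h1 := Nat.mul_le_mul_right (2 * a - (b + 1)) (hFcard v)
      have h2 := Nat.mul_le_mul_right (b + 1 - a) (hb x)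
      rw [← SimpleGraph.card_neighborFinset_eq_degree] at h2
      omega
  · push Not at hI
    have hedge : ∀ p q : Fin n, (∀ x ∈ F p, x ∉ F q) → (∀ x ∈ F p, ∀ y ∈ F q, ¬ G.Adj x y) →
        ∃ x ∈ F p, ∃ y ∈ F p, G.Adj x y := by
      intro p q hpq hpq'
      have hp := hFcard p
      obtain ⟨x, hx⟩ : (F p).Nonempty := Finset.card_pos.1 (by omega)
      by_contra! hnone
      have hdisj : Disjoint (F p) (G.neighborFinset x) := by
        rw [Finset.disjoint_left]
        intro y hy hy'
        exact hnone x hx y hy (by simpa using hy')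
      have hsub : F p ∪ G.neighborFinset x ⊆ (F q)ᶜ := by
        intro y hy
        rw [Finset.mem_compl]
        rcases Finset.mem_union.1 hy with hy | hy
        · exact hpq y hy
        · exact fun h => hpq' x hx y h (by simpa using hy)
      have h1 := Finset.card_le_card hsub
      rw [Finset.card_union_of_disjoint hdisj, hF, compl_compl] at h1
      have h2 := hclosed q
      have h3 : a ≤ (G.neighborFinset x).card := ha x
      change (F p).card + _ ≤ _ at h1
      omega
    obtain ⟨x, hx, y, hy, hxy⟩ := hedge v u hI hsep
    obtain ⟨z, hz, t, ht, hzt⟩ := hedge u v (fun x hx hx' => hI x hx' hx)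
      (fun x hx y hy h => hsep y hy x hx h.symm)
    refine hno (exists_hexagon_switch G (x := x) (y := y) (z := z) (t := t) hvw huw huv ?_ ?_ hxy
      (hsep y hy z hz) ?_ hzt ?_ ?_ (fun h => hsep x hx t ht h.symm) ?_ ?_ ?_ ?_ ?_) <;> grind

/-- Numerical conditions for degrees in the range `[r - t, r + t]` with `t ^ 2 ≤ r`. -/
theorem switch_count_of_sq_le {n r t : ℕ} (hr : 2 ≤ r) (ht : t * t ≤ r) (hn : 6000 ≤ n)
    (hrn : r + 9 * t + 5 < n) :
    (r + t + 1) * (r + t) < (n - (r + t + 1)) * (r - t) ∨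
      (r + t) * (r + t + 1 - (r - t)) <
        (n - (r + t + 1)) * (2 * (r - t) - (r + t + 1)) := by
  by_cases h64 : r < 64
  · left
    have ht8 : t < 8 := by nlinarith
    have htr : 1 ≤ r - t := by
      have : t < r := by
        by_contra! h
        nlinarith
      omega
    calc (r + t + 1) * (r + t) ≤ 72 * 72 := Nat.mul_le_mul (by omega) (by omega)
      _ < n - (r + t + 1) := by omega
      _ ≤ _ := Nat.le_mul_of_pos_right _ htr
  · right
    push Not at h64
    have ht8 : 8 * t ≤ r := by
      by_contra! h
      rcases le_or_gt t 8 with h8 | h8 <;> nlinarith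
    obtain ⟨m, hm⟩ : ∃ m, n = r + t + 1 + m := ⟨n - (r + t + 1), by omega⟩
    obtain ⟨k, hk⟩ : ∃ k, r = 3 * t + 1 + k := ⟨r - (3 * t + 1), by omega⟩
    have e1 : n - (r + t + 1) = m := by omega
    have e2 : 2 * (r - t) - (r + t + 1) = k := by omega
    have e3 : r + t + 1 - (r - t) = 2 * t + 1 := by omega
    rw [e1, e2, e3]
    calc (r + t) * (2 * t + 1) ≤ (4 * k) * (2 * t + 1) := Nat.mul_le_mul_right _ (by omega)
      _ = (8 * t + 4) * k := by ring
      _ < m * k := Nat.mul_lt_mul_of_pos_right (by omega) (by omega)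

/-- For near-regular degree sequences: given two edges `{u,w}, {u,v}` of a realization,
there is a nearby realization keeping `{u,w}` but avoiding `{u,v}`. -/
theorem keep_edge_remove_edge_close_realization (α ρ : ℝ) (hα0 : 0 < α) (hα : α < 1 / 2)
    (hρ0 : 0 < ρ) (hρ : ρ < 1) :
    ∃ n₁ : ℕ, ∀ n : ℕ, n₁ ≤ n → ∀ r : ℕ, 2 ≤ r → (r : ℝ) ≤ (1 - ρ) * n →
      ∀ d : Fin n → ℕ, (∀ i, |(d i : ℝ) - (r : ℝ)| ≤ (r : ℝ) ^ α) →
        ∀ G ∈ Gd n d, ∀ u v w : Fin n, v ≠ w → G.Adj u w → G.Adj u v →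
          ∃ G' ∈ Gd n d, G'.Adj u w ∧ ¬ G'.Adj u v ∧
            (symmDiff G.edgeSet G'.edgeSet).ncard ≤ 12 := by
  obtain ⟨N, hN⟩ := exists_nat_ge ((15 / ρ) ^ 2)
  refine ⟨max 6000 N, fun n hn r hr hrn d hd G hG u v w hvw huw huv => ?_⟩
  classical
  have hn6 : 6000 ≤ n := (le_max_left _ _).trans hn
  have hnN : (N : ℝ) ≤ n := by exact_mod_cast (le_max_right _ _).trans hn
  set t := Nat.sqrt r with ht
  have htr : t * t ≤ r := Nat.sqrt_le r
  have hr1 : (1 : ℝ) ≤ r := by exact_mod_cast (by omega : 1 ≤ r)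
  have hpow : (r : ℝ) ^ α ≤ √(r : ℝ) := by
    rw [Real.sqrt_eq_rpow]
    exact Real.rpow_le_rpow_of_exponent_le hr1 hα.le
  have hdeg : ∀ i, G.degree i = d i := by
    intro i
    rw [← hG i, degOf, Set.ncard_eq_toFinset_card', ← SimpleGraph.card_neighborFinset_eq_degree]
    rfl
  have hdt : ∀ i, ((d i : ℤ) - r).natAbs ≤ t := by
    intro i
    rw [ht, Nat.le_sqrt, ← sq]
    have h := (hd i).trans hpow
    have h2 : ((d i : ℝ) - r) ^ 2 ≤ r := by
      rw [← sq_abs, ← Real.sq_sqrt (by positivity : (0 : ℝ) ≤ r)]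
      gcongr
      rwa [Real.sq_sqrt (by positivity)]
    zify
    rw [sq_abs]
    exact_mod_cast h2
  have hrn' : r + 9 * t + 5 < n := by
    have h15 : 15 ≤ ρ * √(n : ℝ) := by
      have : 15 / ρ ≤ √(n : ℝ) := Real.le_sqrt_of_sq_le (hN.trans hnN)
      rw [div_le_iff₀ hρ0] at this
      linarith
    have hsq := Real.mul_self_sqrt (by positivity : (0 : ℝ) ≤ n)
    have hrle : (r : ℝ) ≤ n := hrn.trans (by nlinarith [(Nat.cast_nonneg n : (0 : ℝ) ≤ n)])
    have hts : (t : ℝ) ≤ √(n : ℝ) := by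
      apply Real.le_sqrt_of_sq_le
      have : ((t * t : ℕ) : ℝ) ≤ r := by exact_mod_cast htr
      push_cast at this
      nlinarith
    have hs1 : 1 ≤ √(n : ℝ) := Real.one_le_sqrt.2 (by exact_mod_cast (by omega : 1 ≤ n))
    have : (r : ℝ) + 9 * t + 5 < n := by nlinarith
    exact_mod_cast this
  obtain ⟨G', hG', h⟩ := exists_graph_remove_edge (a := r - t) (b := r + t) G
    (fun i => by have := hdt i; have := hdeg i; omega)
    (fun i => by have := hdt i; have := hdeg i; omega)
    (by omega) (switch_count_of_sq_le hr htr hn6 hrn') hvw huw huv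
  exact ⟨G', fun i => (hG' i).trans (hG i), h⟩
end

section
/- For all fixed reals 0 < α < 1/2 and 0 < ρ < 1 there exists n₀ ∈ ℕ such that the following holds for every n ≥ n₀ and every integer r with 2 ≤ r ≤ (1−ρ)n. Let d, d' ∈ ℕⁿ both be (α,r)-near-regular, and suppose there are distinct vertices a, b with d'_a = d_a + 1, d'_b = d_b − 1, and d'_i = dᵢ for all i ∉ {a,b}. Let ∂_d(G(d')) denote the set of graphs G' ∈ G(d') for which there exist a graph G ∈ G(d) and a vertex c ∉ {a,b} with {b,c} ∈ E(G), {a,c} ∉ E(G), and E(G') = (E(G) ∖ {{b,c}}) ∪ {{a,c}} (i.e., G' is obtained from some G ∈ G(d) by a single hinge flip). Then n²³ · |∂_d(G(d'))| ≥ |G(d')|. -/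
/-- `∂_d(G(d'))`: graphs `G' ∈ G(d')` obtained from some `G ∈ G(d)` by a single hinge
flip replacing an edge `{b,c}` by the non-edge `{a,c}` (with `c ∉ {a,b}`). -/
def hingeBoundary (n : ℕ) (d d' : Fin n → ℕ) (a b : Fin n) :
    Set (SimpleGraph (Fin n)) :=
  {G' | G' ∈ Gd n d' ∧ ∃ G ∈ Gd n d, ∃ c : Fin n, c ≠ a ∧ c ≠ b ∧
    G.Adj b c ∧ ¬ G.Adj a c ∧
    G'.edgeSet = (G.edgeSet \ {s(b, c)}) ∪ {s(a, c)}}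

open Finset

/-- The closed walk `p q s t p` as a graph; toggling its edges in a graph in which they
alternate between edges and non-edges is a degree-preserving switch. -/
def fourCycle {n : ℕ} (p q s t : Fin n) : SimpleGraph (Fin n) :=
  SimpleGraph.fromEdgeSet {s(p, q), s(q, s), s(s, t), s(t, p)}

lemma symmDiff_fourCycle_adj {n : ℕ} (G : SimpleGraph (Fin n)) (p q s t u v : Fin n) :
    (symmDiff G (fourCycle p q s t)).Adj u v ↔
      (G.Adj u v ↔ ¬ (u ≠ v ∧ ((u = p ∧ v = q ∨ u = q ∧ v = p) ∨ (u = q ∧ v = s ∨ u = s ∧ v = q) ∨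
        (u = s ∧ v = t ∨ u = t ∧ v = s) ∨ (u = t ∧ v = p ∨ u = p ∧ v = t)))) := by
  have h : ∀ H : SimpleGraph (Fin n),
      (symmDiff G H).Adj u v ↔ (G.Adj u v ↔ ¬ H.Adj u v) := by
    intro H
    simp only [symmDiff_def, SimpleGraph.sup_adj, SimpleGraph.sdiff_adj]
    tauto
  rw [h, fourCycle, SimpleGraph.fromEdgeSet_adj, and_comm]
  simp only [Set.mem_insert_iff, Set.mem_singleton_iff, Sym2.eq_iff, ne_eq]

lemma symmDiff_fourCycle_self {n : ℕ} (G : SimpleGraph (Fin n)) (u : Fin n) :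
    symmDiff G (fourCycle u u u u) = G := by
  ext v w
  rw [symmDiff_fourCycle_adj]
  grind

lemma degOf_symmDiff_fourCycle {n : ℕ} {G : SimpleGraph (Fin n)} {p q s t : Fin n}
    (hpq : G.Adj p q) (hqs : ¬ G.Adj q s) (hqs' : q ≠ s) (hst : G.Adj s t)
    (htp : ¬ G.Adj t p) (htp' : t ≠ p) (i : Fin n) :
    degOf (symmDiff G (fourCycle p q s t)) i = degOf G i := by
  have hps : p ≠ s := by rintro rfl; exact hqs hpq.symm
  have hqt : q ≠ t := by rintro rfl; exact hqs hst.symm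
  have hsq : ¬ G.Adj s q := fun h => hqs h.symm
  have hpt : ¬ G.Adj p t := fun h => htp h.symm
  have hqp := hpq.symm
  have hts := hst.symm
  have hpq' := hpq.ne
  have hst' := hst.ne
  have exchange : ∀ u v : Fin n, G.Adj i u → ¬ G.Adj i v →
      (∀ w, (symmDiff G (fourCycle p q s t)).Adj i w ↔ w = v ∨ G.Adj i w ∧ w ≠ u) →
      degOf (symmDiff G (fourCycle p q s t)) i = degOf G i := by
    intro u v hu hv h
    have : (symmDiff G (fourCycle p q s t)).neighborSet i =
        insert v (G.neighborSet i \ {u}) := by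
      ext w
      simpa using h w
    rw [degOf, this, degOf]
    exact Set.ncard_exchange hv hu
  simp only [symmDiff_fourCycle_adj] at exchange
  by_cases h1 : i = p
  · subst h1
    exact exchange q t hpq hpt (by grind)
  by_cases h2 : i = q
  · subst h2
    exact exchange p s hqp hqs (by grind)
  by_cases h3 : i = s
  · subst h3
    exact exchange t q hst hsq (by grind)
  by_cases h4 : i = t
  · subst h4
    exact exchange s p hts htp (by grind)
  unfold degOf
  congr 1
  ext w
  simp only [SimpleGraph.mem_neighborSet, symmDiff_fourCycle_adj]
  grind

lemma mem_hingeBoundary_of_adj {n : ℕ} {d d' : Fin n → ℕ} {a b c : Fin n} (hab : a ≠ b)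
    (ha : d' a = d a + 1) (hb : d' b + 1 = d b) (hd : ∀ i, i ≠ a → i ≠ b → d' i = d i)
    {G : SimpleGraph (Fin n)} (hG : G ∈ Gd n d') (hca : c ≠ a) (hcb : c ≠ b)
    (hac : G.Adj a c) (hbc : ¬ G.Adj b c) : G ∈ hingeBoundary n d d' a b := by
  set H : SimpleGraph (Fin n) :=
    SimpleGraph.fromEdgeSet ((G.edgeSet \ {s(a, c)}) ∪ {s(b, c)}) with hH
  have hadj : ∀ u v, H.Adj u v ↔ u ≠ v ∧ ((G.Adj u v ∧ ¬ (u = a ∧ v = c ∨ u = c ∧ v = a)) ∨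
      (u = b ∧ v = c ∨ u = c ∧ v = b)) := by
    intro u v
    simp only [hH, SimpleGraph.fromEdgeSet_adj, Set.mem_union, Set.mem_sdiff,
      SimpleGraph.mem_edgeSet, Set.mem_singleton_iff, Sym2.eq_iff]
    tauto
  refine ⟨hG, H, ?_, c, hca, hcb, ?_, ?_, ?_⟩
  · intro i
    have hGi := hG i
    unfold degOf at hGi ⊢
    by_cases h1 : i = a
    · subst h1
      have : H.neighborSet i = G.neighborSet i \ {c} := by
        ext w
        simp only [SimpleGraph.mem_neighborSet, hadj, Set.mem_sdiff, Set.mem_singleton_iff]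
        grind [SimpleGraph.Adj.ne]
      have h2 := Set.ncard_sdiff_singleton_add_one (show c ∈ G.neighborSet i from hac)
      rw [this]
      lia
    by_cases h2 : i = b
    · subst h2
      have : H.neighborSet i = insert c (G.neighborSet i) := by
        ext w
        simp only [SimpleGraph.mem_neighborSet, hadj, Set.mem_insert_iff]
        grind [SimpleGraph.Adj.ne]
      rw [this, Set.ncard_insert_of_notMem (show c ∉ G.neighborSet i from hbc)]
      lia
    rw [← hd i h1 h2, ← hGi]
    by_cases h3 : i = c
    · subst h3
      have : H.neighborSet i = insert b (G.neighborSet i \ {a}) := by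
        ext w
        simp only [SimpleGraph.mem_neighborSet, hadj, Set.mem_sdiff, Set.mem_insert_iff,
          Set.mem_singleton_iff]
        grind [SimpleGraph.Adj.ne]
      rw [this]
      exact Set.ncard_exchange (fun h => hbc h.symm) hac.symm
    congr 1
    ext w
    simp only [SimpleGraph.mem_neighborSet, hadj]
    grind [SimpleGraph.Adj.ne]
  · rw [hadj]; grind
  · rw [hadj]; grind
  · ext e
    induction e with | _ u v
    simp only [SimpleGraph.mem_edgeSet, Set.mem_union, Set.mem_sdiff, Set.mem_singleton_iff,
      Sym2.eq_iff, hadj]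
    have := G.ne_of_adj (a := u) (b := v)
    have := hac.symm
    have : ¬ G.Adj c b := fun h => hbc h.symm
    grind

lemma symmDiff_fourCycle_mem_hingeBoundary {n : ℕ} {d d' : Fin n → ℕ} {a b : Fin n}
    (hab : a ≠ b)
    (ha : d' a = d a + 1) (hb : d' b + 1 = d b) (hd : ∀ i, i ≠ a → i ≠ b → d' i = d i)
    {G : SimpleGraph (Fin n)} (hG : G ∈ Gd n d') {c x y : Fin n} (hca : c ≠ a) (hcb : c ≠ b)
    (hac : ¬ G.Adj a c) (hbc : ¬ G.Adj b c) (hxa : G.Adj x a) (hcy : G.Adj c y)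
    (hyx : ¬ G.Adj y x) (hyx' : y ≠ x) :
    symmDiff G (fourCycle x a c y) ∈ hingeBoundary n d d' a b := by
  have hxc : x ≠ c := by rintro rfl; exact hac hxa.symm
  have hyb : y ≠ b := by rintro rfl; exact hbc hcy.symm
  have hcy' := hcy.ne
  refine mem_hingeBoundary_of_adj (c := c) hab ha hb hd ?_ hca hcb ?_ ?_
  · intro i
    rw [degOf_symmDiff_fourCycle hxa hac hca.symm hcy hyx hyx']
    exact hG i
  · rw [symmDiff_fourCycle_adj]; grind
  · rw [symmDiff_fourCycle_adj]; grind

lemma exists_alternating_path {n lo hi : ℕ} {G : SimpleGraph (Fin n)} {a b : Fin n}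
    (hlo : ∀ i, lo ≤ degOf G i) (hhi : ∀ i, degOf G i ≤ hi)
    (hlt : (hi + 1) * (hi - lo + 1) < (n - (hi + 3)) * lo)
    (hsub : ∀ c, c ≠ a → c ≠ b → G.Adj a c → G.Adj b c) :
    ∃ x c y, G.Adj x a ∧ c ≠ a ∧ c ≠ b ∧ ¬ G.Adj a c ∧ ¬ G.Adj b c ∧ G.Adj c y ∧
      ((¬ G.Adj y x ∧ y ≠ x) ∨ ((G.Adj y x ∨ y = x) ∧ ∃ z w, ¬ G.Adj y z ∧ y ≠ z ∧ G.Adj z w ∧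
        w ≠ c ∧ ¬ G.Adj w c ∧ ¬ G.Adj w x ∧ w ≠ x)) := by
  classical
  have hdeg : ∀ i, degOf G i = #(G.neighborFinset i) := by
    intro i
    rw [degOf, ← Set.ncard_coe_finset, SimpleGraph.coe_neighborFinset]
  simp only [hdeg] at hlo hhi
  have hlo1 : 1 ≤ lo := by
    by_contra! h
    have : lo = 0 := by lia
    simp [this] at hlt
  have hn : hi + 3 < n := by
    by_contra! h
    have : n - (hi + 3) = 0 := by lia
    simp [this] at hlt
  obtain ⟨x, hx⟩ : (G.neighborFinset a).Nonempty := by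
    rw [← Finset.card_pos]
    exact hlo1.trans (hlo a)
  rw [SimpleGraph.mem_neighborFinset] at hx
  obtain ⟨w, hw⟩ : ∃ w, w ∉ insert x (G.neighborFinset x) := by
    by_contra! h
    have h1 := Finset.card_insert_le x (G.neighborFinset x)
    rw [Finset.eq_univ_of_forall h, Finset.card_univ, Fintype.card_fin] at h1
    have := hhi x
    lia
  simp only [Finset.mem_insert, SimpleGraph.mem_neighborFinset, not_or] at hw
  by_contra! hno
  have hno := fun c y => hno x c y hx.symm
  set C : Finset (Fin n) := (insert w (insert a (insert b (G.neighborFinset b))))ᶜ with hC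
  have hCmem : ∀ c ∈ C, c ≠ w ∧ c ≠ a ∧ c ≠ b ∧ ¬ G.Adj a c ∧ ¬ G.Adj b c := by
    intro c hc
    simp only [hC, Finset.mem_compl, Finset.mem_insert, SimpleGraph.mem_neighborFinset,
      not_or] at hc
    exact ⟨hc.1, hc.2.1, hc.2.2.1, fun h => hc.2.2.2 (hsub c hc.2.1 hc.2.2.1 h), hc.2.2.2⟩
  have hCcard : n - (hi + 3) ≤ #C := by
    rw [hC, Finset.card_compl, Fintype.card_fin]
    have h1 := Finset.card_insert_le w (insert a (insert b (G.neighborFinset b)))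
    have h2 := Finset.card_insert_le a (insert b (G.neighborFinset b))
    have h3 := Finset.card_insert_le b (G.neighborFinset b)
    have := hhi b
    lia
  have hNC : ∀ c ∈ C, ∀ y, G.Adj c y → G.Adj y x ∨ y = x := by
    intro c hc y hy
    obtain ⟨-, h1, h2, h3, h4⟩ := hCmem c hc
    have := (hno c y h1 h2 h3 h4 hy).1
    tauto
  have hwC : ∀ c ∈ C, ¬ G.Adj c w := by
    intro c hc h
    rcases hNC c hc w h with h | h
    · exact hw.2 h.symm
    · exact hw.1 h
  have hcount : #C * lo ≤ #(insert x (G.neighborFinset x)) * (hi - lo + 1) := by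
    refine Finset.card_mul_le_card_mul G.Adj (fun c hc => ?_) (fun y _ => ?_)
    · refine (hlo c).trans (Finset.card_le_card fun y hy => ?_)
      rw [SimpleGraph.mem_neighborFinset] at hy
      simp only [Finset.mem_bipartiteAbove, Finset.mem_insert, SimpleGraph.mem_neighborFinset]
      exact ⟨(hNC c hc y hy).symm.imp id (·.symm), hy⟩
    · rcases Finset.eq_empty_or_nonempty (C.bipartiteBelow G.Adj y) with h | ⟨c, hc⟩
      · simp [h]
      rw [Finset.mem_bipartiteBelow] at hc
      obtain ⟨h0, h1, h2, h3, h4⟩ := hCmem c hc.1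
      have hjoin : ∀ z, G.Adj z w → y ≠ z → G.Adj y z := by
        intro z hzw hyz
        by_contra h
        exact hw.1 ((hno c y h1 h2 h3 h4 hc.2).2 (hNC c hc.1 y hc.2) z w h hyz hzw h0.symm
          (fun h => hwC c hc.1 h.symm) (fun h => hw.2 h.symm))
      have hdisj : Disjoint ((G.neighborFinset w).erase y) (C.bipartiteBelow G.Adj y) := by
        rw [Finset.disjoint_left]
        intro z hz hz'
        rw [Finset.mem_erase, SimpleGraph.mem_neighborFinset] at hz
        rw [Finset.mem_bipartiteBelow] at hz'
        exact hwC z hz'.1 hz.2.symm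
      have hle : #((G.neighborFinset w).erase y ∪ C.bipartiteBelow G.Adj y) ≤
          #(G.neighborFinset y) := by
        refine Finset.card_le_card fun z hz => ?_
        rw [Finset.mem_union, Finset.mem_erase, Finset.mem_bipartiteBelow,
          SimpleGraph.mem_neighborFinset] at hz
        rw [SimpleGraph.mem_neighborFinset]
        rcases hz with hz | hz
        · exact hjoin z hz.2.symm hz.1.symm
        · exact hz.2.symm
      rw [Finset.card_union_of_disjoint hdisj] at hle
      have := Finset.pred_card_le_card_erase (s := G.neighborFinset w) (a := y)
      have := hlo w
      have := hhi y
      lia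
  have hxcard : #(insert x (G.neighborFinset x)) ≤ hi + 1 :=
    (Finset.card_insert_le _ _).trans (by have := hhi x; lia)
  have h1 := Nat.mul_le_mul_right lo hCcard
  have h2 := Nat.mul_le_mul_right (hi - lo + 1) hxcard
  lia

lemma exists_switches_mem_hingeBoundary {n lo hi : ℕ} {d d' : Fin n → ℕ} {a b : Fin n}
    (hab : a ≠ b)
    (ha : d' a = d a + 1) (hb : d' b + 1 = d b) (hd : ∀ i, i ≠ a → i ≠ b → d' i = d i)
    (hlo : ∀ i, lo ≤ d' i) (hhi : ∀ i, d' i ≤ hi)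
    (hlt : (hi + 1) * (hi - lo + 1) < (n - (hi + 3)) * lo)
    {G : SimpleGraph (Fin n)} (hG : G ∈ Gd n d') :
    ∃ p q s t p' q' s' t' : Fin n,
      symmDiff (symmDiff G (fourCycle p q s t)) (fourCycle p' q' s' t') ∈
        hingeBoundary n d d' a b := by
  by_cases hsub : ∀ c, c ≠ a → c ≠ b → G.Adj a c → G.Adj b c
  · obtain ⟨x, c, y, hxa, hca, hcb, hac, hbc, hcy, ⟨h, h'⟩ |
      ⟨hyx, z, w, hyz, hyz', hzw, hwc', hwc, hwx, hwx'⟩⟩ :=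
      exists_alternating_path (fun i => (hlo i).trans_eq (hG i).symm)
        (fun i => (hG i).trans_le (hhi i)) hlt hsub
    · refine ⟨a, a, a, a, x, a, c, y, ?_⟩
      rw [symmDiff_fourCycle_self]
      exact symmDiff_fourCycle_mem_hingeBoundary hab ha hb hd hG hca hcb hac hbc hxa hcy h h'
    · have hwa : w ≠ a := by rintro rfl; exact hwx hxa.symm
      have hwb : w ≠ b := by
        rintro rfl
        exact hwx (hsub x hxa.ne hwx'.symm hxa.symm)
      have hxc : x ≠ c := by rintro rfl; exact hac hxa.symm
      have hya : y ≠ a := by rintro rfl; exact hac hcy.symm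
      have hyb : y ≠ b := by rintro rfl; exact hbc hcy.symm
      have hyw : y ≠ w := by
        rintro rfl
        exact hyx.elim hwx hwx'
      have hzc : z ≠ c := by rintro rfl; exact hyz hcy.symm
      have hzw' := hzw.ne
      have hcy' := hcy.ne
      refine ⟨c, y, z, w, x, a, c, w, ?_⟩
      refine symmDiff_fourCycle_mem_hingeBoundary hab ha hb hd ?_ hca hcb ?_ ?_ ?_ ?_ ?_ hwx'
      · intro i
        rw [degOf_symmDiff_fourCycle hcy hyz hyz' hzw hwc hwc']
        exact hG i
      all_goals rw [symmDiff_fourCycle_adj]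
      · grind
      · grind
      · grind
      · have hcw : ¬ G.Adj c w := fun h => hwc h.symm
        grind
      · grind
  · push Not at hsub
    obtain ⟨c, hca, hcb, hac, hbc⟩ := hsub
    refine ⟨a, a, a, a, a, a, a, a, ?_⟩
    rw [symmDiff_fourCycle_self, symmDiff_fourCycle_self]
    exact mem_hingeBoundary_of_adj hab ha hb hd hG hca hcb hac hbc

lemma ncard_Gd_le {n lo hi : ℕ} {d d' : Fin n → ℕ} {a b : Fin n} (hab : a ≠ b)
    (ha : d' a = d a + 1) (hb : d' b + 1 = d b) (hd : ∀ i, i ≠ a → i ≠ b → d' i = d i)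
    (hlo : ∀ i, lo ≤ d' i) (hhi : ∀ i, d' i ≤ hi)
    (hlt : (hi + 1) * (hi - lo + 1) < (n - (hi + 3)) * lo) :
    (Gd n d').ncard ≤ n ^ 8 * (hingeBoundary n d d' a b).ncard := by
  let f : (Fin 8 → Fin n) × SimpleGraph (Fin n) → SimpleGraph (Fin n) := fun v =>
    symmDiff (symmDiff v.2 (fourCycle (v.1 4) (v.1 5) (v.1 6) (v.1 7)))
      (fourCycle (v.1 0) (v.1 1) (v.1 2) (v.1 3))
  have hsub : Gd n d' ⊆ f '' (Set.univ ×ˢ hingeBoundary n d d' a b) := by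
    intro G hG
    obtain ⟨p, q, s, t, p', q', s', t', h⟩ :=
      exists_switches_mem_hingeBoundary hab ha hb hd hlo hhi hlt hG
    refine ⟨(![p, q, s, t, p', q', s', t'],
      symmDiff (symmDiff G (fourCycle p q s t)) (fourCycle p' q' s' t')),
      ⟨Set.mem_univ _, h⟩, ?_⟩
    simp [f]
  calc (Gd n d').ncard ≤ (f '' (Set.univ ×ˢ hingeBoundary n d d' a b)).ncard :=
        Set.ncard_le_ncard hsub (Set.toFinite _)
    _ ≤ (Set.univ ×ˢ hingeBoundary n d d' a b : Set ((Fin 8 → Fin n) × _)).ncard :=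
        Set.ncard_image_le (Set.toFinite _)
    _ = n ^ 8 * (hingeBoundary n d d' a b).ncard := by
        rw [Set.ncard_prod, Set.ncard_univ, Nat.card_eq_fintype_card]
        simp

lemma near_regular_bounds {ρ : ℝ} (hρ0 : 0 < ρ) {n r : ℕ} (hn : (40 / ρ) ^ 2 < n)
    (hr : 2 ≤ r) (hrn : (r : ℝ) ≤ (1 - ρ) * n) {lo hi : ℕ}
    (hlo : (r : ℝ) - √r ≤ lo) (hhi : (hi : ℝ) ≤ r + √r) (hlohi : lo ≤ hi) :
    (hi + 1) * (hi - lo + 1) < (n - (hi + 3)) * lo := by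
  have hr' : (2 : ℝ) ≤ r := by exact_mod_cast hr
  have hs0 := Real.sqrt_nonneg (r : ℝ)
  have hs := Real.sq_sqrt (show (0 : ℝ) ≤ r by positivity)
  have ht0 := Real.sqrt_nonneg (n : ℝ)
  have ht := Real.sq_sqrt (show (0 : ℝ) ≤ n by positivity)
  have hρn : 0 ≤ ρ * n := by positivity
  have hrn' : (r : ℝ) ≤ n := by linarith
  have hst : √(r : ℝ) ≤ √n := Real.sqrt_le_sqrt hrn'
  have hs1 : 1 ≤ √(r : ℝ) := Real.one_le_sqrt.mpr (by linarith)
  have hsr : √(r : ℝ) ≤ 3 / 4 * r := by nlinarith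
  have hbig : 40 < ρ * √n := by
    have := Real.lt_sqrt_of_sq_lt hn
    rwa [div_lt_iff₀' hρ0] at this
  have hbig' : 40 * √n < ρ * n := by nlinarith
  have hgap : 36 * √n < (n : ℝ) - (hi + 3) := by linarith
  have hn3 : hi + 3 ≤ n := by
    have : ((hi + 3 : ℕ) : ℝ) ≤ n := by push_cast; linarith
    exact_mod_cast this
  have key : ((hi : ℝ) + 1) * (hi - lo + 1) < (n - (hi + 3)) * lo := by
    have hlohi' : (lo : ℝ) ≤ hi := by exact_mod_cast hlohi
    calc ((hi : ℝ) + 1) * (hi - lo + 1) ≤ (3 * r) * (3 * √n) := by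
          apply mul_le_mul <;> linarith
      _ = (36 * √n) * (r / 4) := by ring
      _ < (n - (hi + 3)) * (r / 4) := by
          apply mul_lt_mul_of_pos_right hgap; linarith
      _ ≤ (n - (hi + 3)) * lo := by
          apply mul_le_mul_of_nonneg_left <;> linarith
  have : (((hi + 1) * (hi - lo + 1) : ℕ) : ℝ) < ((n - (hi + 3)) * lo : ℕ) := by
    push_cast [Nat.cast_sub hlohi, Nat.cast_sub hn3]
    exact key
  exact_mod_cast this

/-- For near-regular degree sequences `d, d'` differing by a unit transfer from `b` to
`a`, the hinge-flip boundary of `G(d')` is at least a `1/n²³` fraction of `G(d')`. -/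
theorem hinge_boundary_large (α ρ : ℝ) (hα0 : 0 < α) (hα : α < 1 / 2)
    (hρ0 : 0 < ρ) (hρ : ρ < 1) :
    ∃ n₀ : ℕ, ∀ n : ℕ, n₀ ≤ n → ∀ r : ℕ, 2 ≤ r → (r : ℝ) ≤ (1 - ρ) * n →
      ∀ d d' : Fin n → ℕ,
        (∀ i, |(d i : ℝ) - (r : ℝ)| ≤ (r : ℝ) ^ α) →
        (∀ i, |(d' i : ℝ) - (r : ℝ)| ≤ (r : ℝ) ^ α) →
        ∀ a b : Fin n, a ≠ b →
          d' a = d a + 1 → d' b + 1 = d b → (∀ i, i ≠ a → i ≠ b → d' i = d i) →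
          n ^ 23 * (hingeBoundary n d d' a b).ncard ≥ (Gd n d').ncard := by
  obtain ⟨n₀, hn₀⟩ := exists_nat_gt ((40 / ρ) ^ 2)
  refine ⟨n₀, fun n hn r hr hrn d d' _ hd' a b hab ha hb hd => ?_⟩
  have hsqrt : (r : ℝ) ^ α ≤ √r := by
    rw [Real.sqrt_eq_rpow]
    exact Real.rpow_le_rpow_of_exponent_le (by exact_mod_cast (by lia : 1 ≤ r)) hα.le
  have hlo : ∀ i, ⌈(r : ℝ) - √r⌉₊ ≤ d' i := fun i => by
    rw [Nat.ceil_le]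
    linarith [(abs_le.mp (hd' i)).1]
  have hhi : ∀ i, d' i ≤ ⌊(r : ℝ) + √r⌋₊ := fun i =>
    Nat.le_floor (by linarith [(abs_le.mp (hd' i)).2])
  have hlt := near_regular_bounds hρ0 (hn₀.trans_le (by exact_mod_cast hn)) hr hrn
    (Nat.le_ceil _) (Nat.floor_le (by positivity)) ((hlo a).trans (hhi a))
  calc (Gd n d').ncard ≤ n ^ 8 * (hingeBoundary n d d' a b).ncard :=
        ncard_Gd_le hab ha hb hd hlo hhi hlt
    _ ≤ n ^ 23 * (hingeBoundary n d d' a b).ncard :=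
        Nat.mul_le_mul_right _ (Nat.pow_le_pow_right a.pos (by norm_num))
end

section
/- Let n ∈ ℕ, let d ∈ ℕⁿ, let a ≠ b be vertices in [n] with d_b ≥ 1, and let d' ∈ ℕⁿ be given by d'_a = d_a + 1, d'_b = d_b − 1, and d'_i = dᵢ for i ∉ {a,b}. Define H = {G ∈ G(d) : ∃ c ∉ {a,b} with {b,c} ∈ E(G) and {a,c} ∉ E(G)}, and let ∂_d(G(d')) be the set of graphs G' ∈ G(d') for which there exist G ∈ G(d) and a vertex c ∉ {a,b} with {b,c} ∈ E(G), {a,c} ∉ E(G), and E(G') = (E(G) ∖ {{b,c}}) ∪ {{a,c}}. Then n · |∂_d(G(d'))| ≥ |H|. -/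
/-- `H`: realizations of `d` admitting a hinge flip moving an edge from `b` to `a`. -/
def Hset (n : ℕ) (d : Fin n → ℕ) (a b : Fin n) : Set (SimpleGraph (Fin n)) :=
  {G | G ∈ Gd n d ∧ ∃ c : Fin n, c ≠ a ∧ c ≠ b ∧ G.Adj b c ∧ ¬ G.Adj a c}

/-- The graph obtained from `G` by deleting the edge `{b,c}` and adding the edge `{a,c}`. -/
def hingeFlip {V : Type*} (G : SimpleGraph V) (a b c : V) : SimpleGraph V :=
  G.deleteEdges {s(b, c)} ⊔ SimpleGraph.edge a c

section hingeFlip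

variable {V : Type*} {G : SimpleGraph V} {a b c : V}

lemma edgeSet_hingeFlip (hca : c ≠ a) :
    (hingeFlip G a b c).edgeSet = (G.edgeSet \ {s(b, c)}) ∪ {s(a, c)} := by
  rw [hingeFlip, SimpleGraph.edgeSet_sup, SimpleGraph.edgeSet_deleteEdges,
    SimpleGraph.edgeSet_edge_of_ne hca.symm]

lemma hingeFlip_adj (hca : c ≠ a) (u v : V) :
    (hingeFlip G a b c).Adj u v ↔ G.Adj u v ∧ s(u, v) ≠ s(b, c) ∨ s(u, v) = s(a, c) := by
  rw [← SimpleGraph.mem_edgeSet, edgeSet_hingeFlip hca]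
  rfl

lemma edgeSet_eq_of_hingeFlip (hca : c ≠ a) (hbc : G.Adj b c) (hac : ¬ G.Adj a c) :
    G.edgeSet = ((hingeFlip G a b c).edgeSet \ {s(a, c)}) ∪ {s(b, c)} := by
  rw [edgeSet_hingeFlip hca]
  ext e
  have h₁ : e = s(b, c) → e ∈ G.edgeSet := by rintro rfl; exact hbc
  have h₂ : e = s(a, c) → e ∉ G.edgeSet := by rintro rfl; exact hac
  simp only [Set.mem_union, Set.mem_sdiff, Set.mem_singleton_iff]
  tauto

lemma neighborSet_hingeFlip_left (hab : a ≠ b) (hca : c ≠ a) :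
    (hingeFlip G a b c).neighborSet a = insert c (G.neighborSet a) := by
  ext v
  simp only [SimpleGraph.mem_neighborSet, hingeFlip_adj hca, Set.mem_insert_iff, Sym2.eq_iff, ne_eq]
  grind

lemma neighborSet_hingeFlip_right (hab : a ≠ b) (hca : c ≠ a) (hcb : c ≠ b) :
    (hingeFlip G a b c).neighborSet b = G.neighborSet b \ {c} := by
  ext v
  simp only [SimpleGraph.mem_neighborSet, hingeFlip_adj hca, Set.mem_sdiff, Set.mem_singleton_iff,
    Sym2.eq_iff, ne_eq]
  grind

lemma neighborSet_hingeFlip_center (hca : c ≠ a) (hcb : c ≠ b) :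
    (hingeFlip G a b c).neighborSet c = insert a (G.neighborSet c \ {b}) := by
  ext v
  simp only [SimpleGraph.mem_neighborSet, hingeFlip_adj hca, Set.mem_insert_iff, Set.mem_sdiff,
    Set.mem_singleton_iff, Sym2.eq_iff, ne_eq]
  grind

lemma neighborSet_hingeFlip_of_ne (hca : c ≠ a) {i : V} (hia : i ≠ a) (hib : i ≠ b)
    (hic : i ≠ c) : (hingeFlip G a b c).neighborSet i = G.neighborSet i := by
  ext v
  simp only [SimpleGraph.mem_neighborSet, hingeFlip_adj hca, Sym2.eq_iff, ne_eq]
  grind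

end hingeFlip

lemma hingeFlip_mem_Gd {n : ℕ} {d d' : Fin n → ℕ} {a b c : Fin n} {G : SimpleGraph (Fin n)}
    (hab : a ≠ b) (ha' : d' a = d a + 1) (hb' : d' b + 1 = d b)
    (hoth : ∀ i, i ≠ a → i ≠ b → d' i = d i) (hG : G ∈ Gd n d)
    (hca : c ≠ a) (hcb : c ≠ b) (hbc : G.Adj b c) (hac : ¬ G.Adj a c) :
    hingeFlip G a b c ∈ Gd n d' := by
  intro i
  have hd := hG i
  unfold degOf at hd ⊢
  rcases eq_or_ne i a with rfl | hia
  · rw [neighborSet_hingeFlip_left hab hca, Set.ncard_insert_of_notMem (by simpa using hac), hd, ha']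
  rcases eq_or_ne i b with rfl | hib
  · have := Set.ncard_sdiff_singleton_add_one (s := G.neighborSet i) (a := c) hbc
    rw [neighborSet_hingeFlip_right hab hca hcb]
    omega
  rw [hoth i hia hib]
  rcases eq_or_ne i c with rfl | hic
  · have := Set.ncard_sdiff_singleton_add_one (s := G.neighborSet i) (a := b) hbc.symm
    rw [neighborSet_hingeFlip_center hca hcb,
      Set.ncard_insert_of_notMem fun h => hac (G.adj_symm h.1)]
    omega
  · rw [neighborSet_hingeFlip_of_ne hca hia hib hic, hd]

/-- Each hinge-flipped graph has at most `n` preimages: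
`n · |∂_d(G(d'))| ≥ |H|`. -/
theorem hinge_boundary_vs_Hset (n : ℕ) (d d' : Fin n → ℕ) (a b : Fin n) (hab : a ≠ b)
    (hb : 1 ≤ d b) (ha' : d' a = d a + 1) (hb' : d' b + 1 = d b)
    (hoth : ∀ i, i ≠ a → i ≠ b → d' i = d i) :
    n * (hingeBoundary n d d' a b).ncard ≥ (Hset n d a b).ncard := by
  have hc : ∀ G : SimpleGraph (Fin n), ∃ c : Fin n, G ∈ Hset n d a b →
      c ≠ a ∧ c ≠ b ∧ G.Adj b c ∧ ¬ G.Adj a c := fun G => by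
    by_cases hG : G ∈ Hset n d a b
    · exact hG.2.imp fun c h _ => h
    · exact ⟨a, fun h => absurd h hG⟩
  choose c hc using hc
  have hle : (Hset n d a b).ncard ≤
      (hingeBoundary n d d' a b ×ˢ (Set.univ : Set (Fin n))).ncard := by
    refine Set.ncard_le_ncard_of_injOn (fun G => (hingeFlip G a b (c G), c G)) ?_ ?_
      (Set.toFinite _)
    · intro G hG
      obtain ⟨hca, hcb, hbc, hac⟩ := hc G hG
      exact ⟨⟨hingeFlip_mem_Gd hab ha' hb' hoth hG.1 hca hcb hbc hac,
        G, hG.1, c G, hca, hcb, hbc, hac, edgeSet_hingeFlip hca⟩, Set.mem_univ _⟩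
    · intro G₁ h₁ G₂ h₂ h
      obtain ⟨hca₁, -, hbc₁, hac₁⟩ := hc G₁ h₁
      obtain ⟨hca₂, -, hbc₂, hac₂⟩ := hc G₂ h₂
      obtain ⟨hflip, hcc⟩ := Prod.ext_iff.mp h
      dsimp only at hflip hcc
      rw [← SimpleGraph.edgeSet_inj, edgeSet_eq_of_hingeFlip hca₁ hbc₁ hac₁,
        edgeSet_eq_of_hingeFlip hca₂ hbc₂ hac₂, hflip, hcc]
  rw [Set.ncard_prod, Set.ncard_univ, Nat.card_fin, mul_comm] at hle
  exact hle
end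

section
/- For all fixed reals 0 < α < 1/2 and 0 < ρ < 1 there exists n₀ ∈ ℕ such that the following holds for every n ≥ n₀ and every integer r with 2 ≤ r ≤ (1−ρ)n. Let d ∈ ℕⁿ be (α,r)-near-regular, and let d' ∈ ℕⁿ be given by d'_a = d_a + 1, d'_b = d_b − 1 for some distinct vertices a, b, and d'_i = dᵢ otherwise. Then |G(d')| ≤ n¹⁰ · |G(d)|. -/
open SimpleGraph symmDiff

lemma degOf_eq_card {n : ℕ} (G : SimpleGraph (Fin n)) [DecidableRel G.Adj] (i : Fin n) :
    degOf G i = (G.neighborFinset i).card :=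
  Set.ncard_eq_toFinset_card' _

lemma degOf_add_of_not_adj {n : ℕ} (G : SimpleGraph (Fin n)) {u v : Fin n} (huv : u ≠ v)
    (h : ¬ G.Adj u v) (i : Fin n) :
    (degOf (G ∆ edge u v) i : ℤ)
      = degOf G i + ((if i = u then 1 else 0) + (if i = v then 1 else 0)) := by
  have hvu : ¬ G.Adj v u := fun h' => h h'.symm
  have key : ∀ j, (G ∆ edge u v).Adj i j ↔
      (G.Adj i j ∨ (i = u ∧ j = v) ∨ (i = v ∧ j = u)) := by
    intro j
    simp only [symmDiff, SimpleGraph.sup_adj, SimpleGraph.sdiff_adj, edge_adj]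
    grind [SimpleGraph.Adj.symm]
  unfold degOf
  by_cases hu : i = u
  · subst hu
    have : (G ∆ edge i v).neighborSet i = insert v (G.neighborSet i) := by
      ext j; simp only [mem_neighborSet, key, Set.mem_insert_iff]; grind
    rw [this, Set.ncard_insert_of_notMem (by simpa using h)]
    simp [huv]
  by_cases hv : i = v
  · subst hv
    have : (G ∆ edge u i).neighborSet i = insert u (G.neighborSet i) := by
      ext j; simp only [mem_neighborSet, key, Set.mem_insert_iff]; grind
    rw [this, Set.ncard_insert_of_notMem (by simpa using hvu)]
    simp [hu]
  · have : (G ∆ edge u v).neighborSet i = G.neighborSet i := by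
      ext j; simp only [mem_neighborSet, key]; grind
    rw [this]; simp [hu, hv]

lemma degOf_sub_of_adj {n : ℕ} (G : SimpleGraph (Fin n)) {u v : Fin n}
    (h : G.Adj u v) (i : Fin n) :
    (degOf (G ∆ edge u v) i : ℤ)
      = degOf G i - ((if i = u then 1 else 0) + (if i = v then 1 else 0)) := by
  have h' : ¬ (G ∆ edge u v).Adj u v := by
    simp [symmDiff, SimpleGraph.sdiff_adj, edge_adj, h, h.ne]
  have := degOf_add_of_not_adj (G ∆ edge u v) h.ne h' i
  rw [symmDiff_symmDiff_cancel_right] at this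
  omega

lemma adj_symmDiff_edge {n : ℕ} (G : SimpleGraph (Fin n)) {u v p q : Fin n}
    (h : ¬ ((p = u ∧ q = v) ∨ (p = v ∧ q = u))) :
    (G ∆ edge u v).Adj p q ↔ G.Adj p q := by
  simp only [symmDiff, SimpleGraph.sup_adj, SimpleGraph.sdiff_adj, edge_adj]
  grind

/-- The edges of the walk `a x y z b`, each counted modulo two. -/
def walkEdges {n : ℕ} (a b : Fin n) (t : Fin n × Fin n × Fin n) : SimpleGraph (Fin n) :=
  edge a t.1 ∆ edge t.1 t.2.1 ∆ edge t.2.1 t.2.2 ∆ edge t.2.2 b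

lemma symmDiff_walkEdges {n : ℕ} (G : SimpleGraph (Fin n)) (a b x y z : Fin n) :
    G ∆ walkEdges a b (x, y, z) = G ∆ edge a x ∆ edge x y ∆ edge y z ∆ edge z b := by
  simp only [walkEdges, symmDiff_assoc]

lemma degOf_symmDiff_short_walk {n : ℕ} (G : SimpleGraph (Fin n)) {a b z : Fin n} (hab : a ≠ b)
    (haz : G.Adj a z) (hzb : ¬ G.Adj z b) (hz : z ≠ b) (i : Fin n) :
    (degOf (G ∆ walkEdges a b (a, a, z)) i : ℤ)
      = degOf G i - (if i = a then 1 else 0) + (if i = b then 1 else 0) := by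
  have haz' := haz.ne
  rw [symmDiff_walkEdges, edge_self_eq_bot, symmDiff_bot, symmDiff_bot,
    degOf_add_of_not_adj _ hz (by rwa [adj_symmDiff_edge _ (by grind)]),
    degOf_sub_of_adj _ haz]
  ring

lemma degOf_symmDiff_long_walk {n : ℕ} (G : SimpleGraph (Fin n)) {a b x y z : Fin n}
    (hab : a ≠ b) (hax : G.Adj a x) (hxb : G.Adj x b) (hxy : ¬ G.Adj x y) (hxy' : x ≠ y)
    (hyz : G.Adj y z) (hzb : ¬ G.Adj z b) (hz : z ≠ b) (i : Fin n) :
    (degOf (G ∆ walkEdges a b (x, y, z)) i : ℤ)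
      = degOf G i - (if i = a then 1 else 0) + (if i = b then 1 else 0) := by
  have h1 := hax.ne
  have h2 := hxb.ne
  have h3 := hyz.ne
  have hya : y ≠ a := by rintro rfl; exact hxy hax.symm
  have hyb : y ≠ b := by rintro rfl; exact hxy hxb
  have hzx : z ≠ x := by rintro rfl; exact hzb hxb
  rw [symmDiff_walkEdges,
    degOf_add_of_not_adj _ hz (by
      rwa [adj_symmDiff_edge _ (by grind), adj_symmDiff_edge _ (by grind),
        adj_symmDiff_edge _ (by grind)]),
    degOf_sub_of_adj _ (by
      rwa [adj_symmDiff_edge _ (by grind), adj_symmDiff_edge _ (by grind)]),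
    degOf_add_of_not_adj _ hxy' (by rwa [adj_symmDiff_edge _ (by grind)]),
    degOf_sub_of_adj _ hax]
  ring

lemma ncard_le_of_forall_exists_symmDiff_mem {n : ℕ} {ι : Type*} [Fintype ι]
    (S T : Set (SimpleGraph (Fin n))) (f : ι → SimpleGraph (Fin n))
    (h : ∀ G ∈ S, ∃ t, G ∆ f t ∈ T) : S.ncard ≤ Fintype.card ι * T.ncard := by
  rcases S.eq_empty_or_nonempty with rfl | ⟨G₀, hG₀⟩
  · simp
  have : Nonempty ι := ⟨(h G₀ hG₀).choose⟩
  choose! t ht using h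
  have := Set.ncard_le_ncard_of_injOn (s := S) (t := (Set.univ : Set ι) ×ˢ T)
    (fun G => (t G, G ∆ f (t G))) (fun G hG => ⟨trivial, ht G hG⟩)
    (fun G _ H _ hGH => by
      simp only [Prod.mk.injEq] at hGH
      rw [hGH.1] at hGH
      exact symmDiff_left_injective _ hGH.2)
    (Set.toFinite _)
  rwa [Set.ncard_prod, Set.ncard_univ, Nat.card_eq_fintype_card] at this

open Classical in
/-- If every neighbour of `Z` is equal or adjacent to every vertex of a set `X` disjoint from `Z`,
then the number of edges leaving `Z` is small. -/
lemma card_mul_le_of_forall_adj {n : ℕ} (G : SimpleGraph (Fin n)) (X Z : Finset (Fin n))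
    (hXZ : Disjoint X Z) (hX : X.Nonempty) (L k U : ℝ) (hk : k ≤ X.card)
    (hkU : k ≤ U + 1)
    (hL : ∀ z ∈ Z, L ≤ degOf G z) (hU : ∀ v, (degOf G v : ℝ) ≤ U)
    (h : ∀ x ∈ X, ∀ z ∈ Z, ∀ y, G.Adj z y → x = y ∨ G.Adj x y) :
    Z.card * L ≤ (U + 1) * (U + 1 - k) := by
  let W : Finset (Fin n) := Finset.univ.filter fun y => ∃ z ∈ Z, G.Adj z y
  have hdouble := Finset.sum_card_bipartiteAbove_eq_sum_card_bipartiteBelow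
    (s := Z) (t := W) G.Adj
  have hlow : ∀ z ∈ Z, L ≤ ((W.bipartiteAbove G.Adj z).card : ℝ) := by
    intro z hz
    refine (hL z hz).trans ?_
    rw [degOf_eq_card]
    exact_mod_cast Finset.card_le_card fun y hy => by
      rw [mem_neighborFinset] at hy
      simp only [Finset.bipartiteAbove, Finset.mem_filter, W, Finset.mem_univ, true_and]
      exact ⟨⟨z, hz, hy⟩, hy⟩
  have hup : ∀ w ∈ W, ((Z.bipartiteBelow G.Adj w).card : ℝ) ≤ U + 1 - k := by
    intro w hw
    obtain ⟨z, hz, hzw⟩ : ∃ z ∈ Z, G.Adj z w := by simpa [W] using hw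
    have hsub : Z.bipartiteBelow G.Adj w ∪ X.erase w ⊆ G.neighborFinset w := by
      intro v hv
      rw [mem_neighborFinset]
      rcases Finset.mem_union.1 hv with hv | hv
      · exact (Finset.mem_filter.1 hv).2.symm
      · obtain ⟨hvw, hvX⟩ := Finset.mem_erase.1 hv
        exact ((h v hvX z hz w hzw).resolve_left hvw).symm
    have hdisj : Disjoint (Z.bipartiteBelow G.Adj w) (X.erase w) :=
      (hXZ.mono (Finset.erase_subset _ _) (Finset.filter_subset _ _)).symm
    have hc := Finset.card_le_card hsub
    rw [Finset.card_union_of_disjoint hdisj, ← degOf_eq_card] at hc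
    have he := Finset.pred_card_le_card_erase (s := X) (a := w)
    have hU' := hU w
    have hc' : (Z.bipartiteBelow G.Adj w).card + X.card ≤ degOf G w + 1 := by omega
    have : ((Z.bipartiteBelow G.Adj w).card : ℝ) + X.card ≤ degOf G w + 1 := by exact_mod_cast hc'
    linarith
  have hW : (W.card : ℝ) ≤ U + 1 := by
    obtain ⟨x, hx⟩ := hX
    have hsub : W ⊆ insert x (G.neighborFinset x) := by
      intro y hy
      obtain ⟨z, hz, hzy⟩ : ∃ z ∈ Z, G.Adj z y := by simpa [W] using hy
      rw [Finset.mem_insert, mem_neighborFinset]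
      exact (h x hx z hz y hzy).imp_left Eq.symm
    have hc := (Finset.card_le_card hsub).trans (Finset.card_insert_le _ _)
    rw [← degOf_eq_card] at hc
    have : (W.card : ℝ) ≤ degOf G x + 1 := by exact_mod_cast hc
    linarith [hU x]
  calc (Z.card : ℝ) * L ≤ ∑ z ∈ Z, ((W.bipartiteAbove G.Adj z).card : ℝ) := by
        rw [← nsmul_eq_mul]; exact Finset.card_nsmul_le_sum _ _ _ hlow
    _ = ∑ w ∈ W, ((Z.bipartiteBelow G.Adj w).card : ℝ) := by exact_mod_cast hdouble
    _ ≤ W.card * (U + 1 - k) := by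
        rw [← nsmul_eq_mul]; exact Finset.sum_le_card_nsmul _ _ _ hup
    _ ≤ (U + 1) * (U + 1 - k) := mul_le_mul_of_nonneg_right hW (by linarith)

lemma not_mul_le_of_large {ρ n r s t c : ℝ} (ht : 0 ≤ t) (htn : t ^ 2 = n)
    (hs : 4 / 3 ≤ s) (hsr : s ^ 2 = r) (hst : s ≤ t) (hn : 49 < ρ * t)
    (hr : r ≤ (1 - ρ) * n) (hc : n - r - s ≤ c) :
    ¬ c * (r - s) ≤ (r + s + 1 + 1) * (r + s + 1 + 1 - (r - s)) := by
  intro h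
  have htpos : 0 < t := by linarith
  have hc1 : 48 * t < c := by nlinarith
  have h1 : r / 4 ≤ r - s := by nlinarith
  have h2 : r + s + 1 + 1 ≤ 3 * r := by nlinarith
  have h3 : r + s + 1 + 1 - (r - s) ≤ 4 * s := by linarith
  have hr0 : 0 < r := by nlinarith
  have h4 : c * (r / 4) ≤ 3 * r * (4 * s) :=
    (mul_le_mul_of_nonneg_left h1 (by linarith)).trans
      (h.trans (mul_le_mul h2 h3 (by linarith) (by linarith)))
  have h5 : r * (c - 48 * s) ≤ 0 := by linarith
  have h6 : 0 < r * (c - 48 * s) := mul_pos hr0 (by linarith)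
  linarith

/-- For a near-regular degree sequence `d` and its unit perturbation `d'`
(one degree raised at `a`, one lowered at `b`), we have `|G(d')| ≤ n¹⁰ · |G(d)|`. -/
theorem perturbed_count_bound (α ρ : ℝ) (hα0 : 0 < α) (hα : α < 1 / 2)
    (hρ0 : 0 < ρ) (hρ : ρ < 1) :
    ∃ n₀ : ℕ, ∀ n : ℕ, n₀ ≤ n → ∀ r : ℕ, 2 ≤ r → (r : ℝ) ≤ (1 - ρ) * n →
      ∀ d d' : Fin n → ℕ, (∀ i, |(d i : ℝ) - (r : ℝ)| ≤ (r : ℝ) ^ α) →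
        ∀ a b : Fin n, a ≠ b →
          d' a = d a + 1 → d' b + 1 = d b → (∀ i, i ≠ a → i ≠ b → d' i = d i) →
          (Gd n d').ncard ≤ n ^ 10 * (Gd n d).ncard := by
  obtain ⟨n₀, hn₀⟩ := exists_nat_gt ((50 / ρ) ^ 2)
  refine ⟨n₀, fun n hn r hr2 hrn d d' hd a b hab ha hb hi => ?_⟩
  have hr2' : (2 : ℝ) ≤ r := by exact_mod_cast hr2
  set s := √(r : ℝ) with hs
  have hsr : s ^ 2 = r := Real.sq_sqrt (by linarith)
  have hs0 : 4 / 3 ≤ s := Real.le_sqrt_of_sq_le (by norm_num; linarith)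
  have hds : ∀ i, |(d i : ℝ) - r| ≤ s := fun i => (hd i).trans <| by
    rw [hs, Real.sqrt_eq_rpow]
    exact Real.rpow_le_rpow_of_exponent_le (by linarith) hα.le
  have hlo : ∀ i, (r : ℝ) - s ≤ d i := fun i => by linarith [(abs_le.1 (hds i)).1]
  have hhi : ∀ i, (d i : ℝ) ≤ r + s := fun i => by linarith [(abs_le.1 (hds i)).2]
  have hn' : (50 / ρ) ^ 2 < n := hn₀.trans_le (by exact_mod_cast hn)
  have hnpos : (0 : ℝ) < n := (sq_nonneg _).trans_lt hn'
  have hn1 : 1 ≤ n := by exact_mod_cast hnpos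
  have htn : √(n : ℝ) ^ 2 = n := Real.sq_sqrt hnpos.le
  have hρt : 49 < ρ * √(n : ℝ) := by
    have : 50 / ρ < √(n : ℝ) := Real.lt_sqrt_of_sq_lt hn'
    rw [div_lt_iff₀ hρ0] at this
    linarith
  have hst : s ≤ √(n : ℝ) := Real.sqrt_le_sqrt (by nlinarith)
  have haR : (d' a : ℝ) = d a + 1 := by exact_mod_cast ha
  have hbR : (d' b : ℝ) + 1 = d b := by exact_mod_cast hb
  have hmain : ∀ G ∈ Gd n d', ∃ t, G ∆ walkEdges a b t ∈ Gd n d := by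
    classical
    intro G hG
    have hfin : ∀ t, (∀ i, (degOf (G ∆ walkEdges a b t) i : ℤ)
        = degOf G i - (if i = a then 1 else 0) + (if i = b then 1 else 0)) →
        G ∆ walkEdges a b t ∈ Gd n d := by
      intro t ht i
      have h1 := ht i
      rw [hG i] at h1
      have h2 := hi i
      split_ifs at h1 with h3 h4 h4 <;> grind
    by_cases hshort : ∃ z, G.Adj a z ∧ ¬ G.Adj z b ∧ z ≠ b
    · obtain ⟨z, h1, h2, h3⟩ := hshort
      exact ⟨_, hfin _ (degOf_symmDiff_short_walk G hab h1 h2 h3)⟩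
    by_cases hlong : ∃ x y z, G.Adj a x ∧ G.Adj x b ∧ ¬ G.Adj x y ∧ x ≠ y ∧ G.Adj y z ∧
        ¬ G.Adj z b ∧ z ≠ b
    · obtain ⟨x, y, z, h1, h2, h3, h4, h5, h6, h7⟩ := hlong
      exact ⟨_, hfin _ (degOf_symmDiff_long_walk G hab h1 h2 h3 h4 h5 h6 h7)⟩
    exfalso
    push Not at hshort hlong
    have hdeg : ∀ v, (G.neighborFinset v).card = d' v := fun v => by
      rw [← hG v, degOf_eq_card]
    let X := (G.neighborFinset a).erase b
    let Z := (insert b (G.neighborFinset b))ᶜ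
    have hXadj : ∀ x ∈ X, G.Adj a x ∧ G.Adj x b := by
      intro x hx
      obtain ⟨h1, h2⟩ := Finset.mem_erase.1 hx
      rw [mem_neighborFinset] at h2
      exact ⟨h2, by_contra fun h => h1 (hshort x h2 h)⟩
    have hZ : ∀ z ∈ Z, z ≠ b ∧ ¬ G.Adj z b := by
      intro z hz
      simpa [Z, G.adj_comm b z] using hz
    have hXcard : (r : ℝ) - s ≤ X.card := by
      have := Finset.pred_card_le_card_erase (s := G.neighborFinset a) (a := b)
      rw [hdeg] at this
      have h' : d a ≤ X.card := by rwa [ha, Nat.add_sub_cancel] at this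
      exact (hlo a).trans (by exact_mod_cast h')
    have hXne : X.Nonempty := by
      rw [← Finset.card_pos]
      have : (0 : ℝ) < X.card := by nlinarith
      exact_mod_cast this
    have hZcard : (n : ℝ) - r - s ≤ Z.card := by
      have h1 : Z.card + (d' b + 1) = n := by
        have h2 := Finset.card_compl_add_card (insert b (G.neighborFinset b))
        rw [Finset.card_insert_of_notMem (by simp), hdeg, Fintype.card_fin] at h2
        exact h2
      have h2 : (Z.card : ℝ) + (d' b + 1) = n := by exact_mod_cast h1
      linarith [hhi b]
    refine not_mul_le_of_large (Real.sqrt_nonneg _) htn hs0 hsr hst hρt hrn hZcard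
      (card_mul_le_of_forall_adj G X Z ?_ hXne (r - s) (r - s) (r + s + 1) hXcard
        (by linarith) ?_ ?_ ?_)
    · exact Finset.disjoint_left.2 fun x hx hz => (hZ x hz).2 (hXadj x hx).2
    · intro z hz
      rw [hG z]
      by_cases hza : z = a
      · subst hza; linarith [hlo z]
      · rw [hi z hza (hZ z hz).1]; exact hlo z
    · intro v
      rw [hG v]
      by_cases hva : v = a
      · subst hva; linarith [hhi v]
      by_cases hvb : v = b
      · subst hvb; linarith [hhi v]
      · rw [hi v hva hvb]; linarith [hhi v]
    · intro x hx z hz y hzy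
      by_contra hcon
      push Not at hcon
      exact (hZ z hz).1
        (hlong x y z (hXadj x hx).1 (hXadj x hx).2 hcon.2 hcon.1 hzy.symm (hZ z hz).2)
  refine (ncard_le_of_forall_exists_symmDiff_mem _ _ _ hmain).trans
    (Nat.mul_le_mul_right _ ?_)
  simp only [Fintype.card_prod, Fintype.card_fin]
  calc n * (n * n) = n ^ 3 := by ring
    _ ≤ n ^ 10 := Nat.pow_le_pow_right hn1 (by norm_num)
end
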